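/- arXiv:math/0102159 — 9 statements merged into one kernel-verified Lean document; each statement's English description precedes it below -/
import Mathlib

section
/- Let K be a compact subgroup of the orthogonal group O(m,ℝ) acting on ℝ^m by matrix multiplication, and let σ₁,…,σ_N be polynomials in m real variables such that each σ_i is K-invariant and such that every K-invariant polynomial in m variables lies in the ℝ-subalgebra generated by σ₁,…,σ_N. Let σ : ℝ^m → ℝ^N be x ↦ (σ₁(x),…,σ_N(x)). Then σ is a proper map, σ(x) = σ(y) holds if and only if y = g·x for some g ∈ K, and consequently the map induced by σ on the orbit space ℝ^m/K (the quotient of ℝ^m by the orbit equivalence relation of K, with the quotient topology) is a homeomorphism onto the image σ(ℝ^m), i.e. the induced map is a closed embedding into ℝ^N. -/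
open MeasureTheory in
lemma hilbert_avg {m : ℕ} {G : Type*} [TopologicalSpace G] [CompactSpace G] [MeasurableSpace G]
    [BorelSpace G] (μ : Measure G) [IsFiniteMeasure μ]
    (A : G → Matrix (Fin m) (Fin m) ℝ) (hA : Continuous A) (p : MvPolynomial (Fin m) ℝ) :
    ∃ P : MvPolynomial (Fin m) ℝ, ∀ x : Fin m → ℝ,
      MvPolynomial.eval x P = ∫ g, MvPolynomial.eval ((A g).mulVec x) p ∂μ := by
  let a : Fin m → Fin m → C(G, ℝ) := fun i j => ⟨fun g => A g i j, hA.matrix_elem i j⟩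
  let q : MvPolynomial (Fin m) C(G, ℝ) :=
    MvPolynomial.aeval (fun i => ∑ j, MvPolynomial.C (a i j) * MvPolynomial.X j) p
  have hq : ∀ g x, MvPolynomial.eval ((A g).mulVec x) p =
      MvPolynomial.eval₂ ((ContinuousMap.evalAlgHom ℝ ℝ g : C(G, ℝ) →ₐ[ℝ] ℝ) : C(G, ℝ) →+* ℝ) x q := by
    intro g x
    simp only [q]
    induction p using MvPolynomial.induction_on with
    | C r =>
      simp [MvPolynomial.algebraMap_eq, MvPolynomial.algebraMap_apply]
    | add p q hp hq => simp only [map_add, MvPolynomial.eval₂_add, hp, hq]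
    | mul_X p i hp =>
      simp only [map_mul, MvPolynomial.eval₂_mul, hp, MvPolynomial.eval_X, MvPolynomial.aeval_X]
      congr 1
      simp [MvPolynomial.eval₂_sum, Matrix.mulVec, dotProduct, a]
  refine ⟨∑ d ∈ q.support, MvPolynomial.monomial d (∫ g, (q.coeff d) g ∂μ), fun x => ?_⟩
  simp_rw [hq, MvPolynomial.eval₂_eq]
  rw [integral_finsetSum]
  · rw [map_sum]
    refine Finset.sum_congr rfl fun d _ => ?_
    rw [MvPolynomial.eval_monomial, integral_mul_const]
    rfl
  · intro d _
    refine Integrable.mul_const ?_ _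
    exact (q.coeff d).continuous.integrable_of_hasCompactSupport
      (HasCompactSupport.of_compactSpace _)

open MeasureTheory in
lemma hilbert_sep {m : ℕ} (G : Subgroup (Matrix.orthogonalGroup (Fin m) ℝ)) [CompactSpace G]
    (x y : Fin m → ℝ) (hxy : ∀ g ∈ G, (g : Matrix (Fin m) (Fin m) ℝ).mulVec x ≠ y) :
    ∃ P : MvPolynomial (Fin m) ℝ,
      (∀ h ∈ G, ∀ z, MvPolynomial.eval ((h : Matrix (Fin m) (Fin m) ℝ).mulVec z) P
        = MvPolynomial.eval z P) ∧
      MvPolynomial.eval x P ≠ MvPolynomial.eval y P := by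
  let ρ : G → Matrix (Fin m) (Fin m) ℝ := fun g => ((g : Matrix.orthogonalGroup (Fin m) ℝ) :
    Matrix (Fin m) (Fin m) ℝ)
  have hρ : Continuous ρ := continuous_subtype_val.comp continuous_subtype_val
  have hmul : ∀ g h : G, ρ (g * h) = ρ g * ρ h := fun g h => rfl
  have hone : ρ 1 = 1 := rfl
  let O : (Fin m → ℝ) → Set (Fin m → ℝ) := fun z => Set.range fun g : G => (ρ g).mulVec z
  have hO : ∀ z, IsCompact (O z) := fun z =>
    isCompact_range (hρ.matrix_mulVec continuous_const)
  have hmem : ∀ z (g : G), (ρ g).mulVec z ∈ O z := fun z g => ⟨g, rfl⟩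
  have hne : ∀ z, (O z).Nonempty := fun z => ⟨_, hmem z 1⟩
  have hdisj : ∀ w ∈ O y, 0 < Metric.infDist w (O x) := by
    rintro w ⟨g, rfl⟩
    rw [← (hO x).isClosed.notMem_iff_infDist_pos (hne x)]
    rintro ⟨h, hh⟩
    refine hxy (g⁻¹ * h : G) (g⁻¹ * h : G).2 ?_
    change (ρ (g⁻¹ * h)).mulVec x = y
    simp only at hh
    rw [hmul, ← Matrix.mulVec_mulVec, hh, Matrix.mulVec_mulVec, ← hmul, inv_mul_cancel, hone,
      Matrix.one_mulVec]
  obtain ⟨w, hw, hmin⟩ := (hO y).exists_isMinOn (hne y)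
    (Metric.continuous_infDist_pt (O x)).continuousOn
  set δ := Metric.infDist w (O x) with hδ
  have hδ0 : 0 < δ := hdisj w hw
  let T : MvPolynomial (Fin m) ℝ →ₐ[ℝ] C(Fin m → ℝ, ℝ) :=
    MvPolynomial.aeval (fun i => ⟨fun z => z i, continuous_apply i⟩)
  have hT : ∀ p z, T p z = MvPolynomial.eval z p := by
    intro p z
    induction p using MvPolynomial.induction_on with
    | C r => simp [T, MvPolynomial.aeval_C]
    | add p q hp hq => simp only [map_add, ContinuousMap.add_apply, hp, hq]
    | mul_X p i hp =>
      simp only [map_mul, ContinuousMap.mul_apply, hp, MvPolynomial.eval_X]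
      simp [T]
  have hsep : T.range.SeparatesPoints := by
    intro u v huv
    obtain ⟨i, hi⟩ := Function.ne_iff.mp huv
    refine ⟨_, ⟨T (MvPolynomial.X i), ⟨_, rfl⟩, rfl⟩, ?_⟩
    simpa [hT] using hi
  obtain ⟨_, ⟨p, rfl⟩, hp⟩ :=
    ContinuousMap.exists_mem_subalgebra_near_continuous_of_isCompact_of_separatesPoints hsep
      ⟨fun z => Metric.infDist z (O x), Metric.continuous_infDist_pt (O x)⟩
      ((hO x).union (hO y)) (show 0 < δ / 3 by positivity)
  replace hp : ∀ z ∈ O x ∪ O y, |MvPolynomial.eval z p - Metric.infDist z (O x)| < δ / 3 := by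
    intro z hz
    have := hp z hz
    rw [Real.norm_eq_abs] at this
    simpa [hT] using this
  letI : MeasurableSpace G := borel G
  haveI : BorelSpace G := ⟨rfl⟩
  let μ : Measure G := Measure.haarMeasure ⊤
  haveI : IsProbabilityMeasure μ := ⟨by
    have := Measure.haarMeasure_self (K₀ := (⊤ : TopologicalSpace.PositiveCompacts G))
    simpa using this⟩
  obtain ⟨P, hP⟩ := hilbert_avg μ (fun g => ρ g⁻¹) (hρ.comp continuous_inv) p
  have hint : ∀ z, Integrable (fun g => MvPolynomial.eval ((ρ g⁻¹).mulVec z) p) μ := by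
    intro z
    refine Continuous.integrable_of_hasCompactSupport ?_ (HasCompactSupport.of_compactSpace _)
    exact (MvPolynomial.continuous_eval p).comp
      ((hρ.comp continuous_inv).matrix_mulVec continuous_const)
  refine ⟨P, ?_, ?_⟩
  · intro h hh z
    rw [hP, hP]
    have := integral_mul_left_eq_self (μ := μ)
      (fun g => MvPolynomial.eval ((ρ g⁻¹).mulVec z) p) (⟨h, hh⟩⁻¹ : G)
    rw [← this]
    refine integral_congr_ae (Filter.Eventually.of_forall fun g => ?_)
    simp only
    rw [mul_inv_rev, inv_inv, hmul, ← Matrix.mulVec_mulVec]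
  · have h1 : MvPolynomial.eval x P ≤ δ / 3 := by
      rw [hP]
      calc _ ≤ ∫ g, δ / 3 ∂μ := by
            refine integral_mono (hint x) (integrable_const _) fun g => ?_
            have := hp _ (Or.inl (hmem x g⁻¹))
            rw [Metric.infDist_zero_of_mem (hmem x g⁻¹), abs_lt] at this
            simp only
            linarith
        _ = δ / 3 := by simp
    have h2 : δ - δ / 3 ≤ MvPolynomial.eval y P := by
      rw [hP]
      calc δ - δ / 3 = ∫ g, (δ - δ / 3) ∂μ := by simp
        _ ≤ _ := by
            refine integral_mono (integrable_const _) (hint y) fun g => ?_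
            have := hp _ (Or.inr (hmem y g⁻¹))
            have h3 : δ ≤ Metric.infDist ((ρ g⁻¹).mulVec y) (O x) := hmin (hmem y g⁻¹)
            rw [abs_lt] at this
            simp only
            linarith
    intro h
    linarith


/-- **Section 2.4**: for a compact subgroup `K ⊆ O(m,ℝ)` and generators `σ₁,…,σ_N` of the
algebra of `K`-invariant polynomials, the map `σ = (σ₁,…,σ_N) : ℝ^m → ℝ^N` is proper,
separates exactly the `K`-orbits, and induces a closed embedding (a homeomorphism onto its
image) of the orbit space `ℝ^m/K` into `ℝ^N`. -/
theorem hilbert_map_induces_closed_embedding_of_orbit_space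
    (m N : ℕ)
    (K : Set (Matrix (Fin m) (Fin m) ℝ))
    (hKO : ∀ g ∈ K, g ∈ Matrix.orthogonalGroup (Fin m) ℝ)
    (hK1 : (1 : Matrix (Fin m) (Fin m) ℝ) ∈ K)
    (hKmul : ∀ g ∈ K, ∀ h ∈ K, g * h ∈ K)
    (hKinv : ∀ g ∈ K, g⁻¹ ∈ K)
    (hKcpt : IsCompact K)
    (σ : Fin N → MvPolynomial (Fin m) ℝ)
    (hσinv : ∀ i, ∀ g ∈ K, ∀ x : Fin m → ℝ,
      MvPolynomial.eval (g.mulVec x) (σ i) = MvPolynomial.eval x (σ i))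
    (hσgen : ∀ p : MvPolynomial (Fin m) ℝ,
      (∀ g ∈ K, ∀ x : Fin m → ℝ,
        MvPolynomial.eval (g.mulVec x) p = MvPolynomial.eval x p) →
      p ∈ Algebra.adjoin ℝ (Set.range σ)) :
    IsProperMap (fun x : Fin m → ℝ => (fun i => MvPolynomial.eval x (σ i) : Fin N → ℝ))
    ∧ (∀ x y : Fin m → ℝ,
        ((fun i => MvPolynomial.eval x (σ i) : Fin N → ℝ)
            = fun i => MvPolynomial.eval y (σ i))
          ↔ ∃ g ∈ K, g.mulVec x = y)
    ∧ (∀ F : Quot (fun x y : Fin m → ℝ => ∃ g ∈ K, g.mulVec x = y) → (Fin N → ℝ),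
        (∀ x : Fin m → ℝ, F (Quot.mk _ x) = fun i => MvPolynomial.eval x (σ i)) →
        Topology.IsClosedEmbedding F) := by

  classical
  have hcont : Continuous (fun x : Fin m → ℝ =>
      (fun i => MvPolynomial.eval x (σ i) : Fin N → ℝ)) :=
    continuous_pi fun i => MvPolynomial.continuous_eval (σ i)
  have hfac : ∀ p : MvPolynomial (Fin m) ℝ,
      (∀ g ∈ K, ∀ x : Fin m → ℝ,
        MvPolynomial.eval (g.mulVec x) p = MvPolynomial.eval x p) →
      ∃ q : MvPolynomial (Fin N) ℝ, ∀ x, MvPolynomial.eval x p =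
        MvPolynomial.eval (fun i => MvPolynomial.eval x (σ i)) q := by
    intro p hp
    have h := hσgen p hp
    rw [Algebra.adjoin_range_eq_range_aeval] at h
    obtain ⟨q, rfl⟩ := h
    refine ⟨q, fun x => ?_⟩
    clear hp
    change MvPolynomial.eval x (MvPolynomial.aeval σ q) = _
    induction q using MvPolynomial.induction_on with
    | C r => simp [MvPolynomial.algebraMap_eq]
    | add p q hp hq => simp_all
    | mul_X p i hp => simp_all
  have hproper : IsProperMap (fun x : Fin m → ℝ =>
      (fun i => MvPolynomial.eval x (σ i) : Fin N → ℝ)) := by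
    obtain ⟨q, hq⟩ := hfac (∑ i, MvPolynomial.X i ^ 2) (by
      intro g hg x
      have h1 : ∀ z : Fin m → ℝ, MvPolynomial.eval z (∑ i, MvPolynomial.X i ^ 2) =
          z ⬝ᵥ z := by
        intro z; simp [dotProduct, sq]
      have h2 : g.transpose * g = 1 := (Matrix.mem_orthogonalGroup_iff' (Fin m) ℝ).mp (hKO g hg)
      rw [h1, h1, Matrix.dotProduct_mulVec, Matrix.vecMul_mulVec, h2, Matrix.vecMul_one])
    rw [isProperMap_iff_isCompact_preimage]
    refine ⟨hcont, fun C hC => ?_⟩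
    obtain ⟨B, hB⟩ := (hC.image (MvPolynomial.continuous_eval q)).bddAbove
    refine (isCompact_closedBall (0 : Fin m → ℝ) (Real.sqrt B)).of_isClosed_subset
      (hC.isClosed.preimage hcont) fun x hx => ?_
    have hxB : ∑ i, x i ^ 2 ≤ B := by
      have h1 := hB ⟨_, hx, rfl⟩
      simp only at h1
      rw [← hq] at h1
      simpa using h1
    rw [mem_closedBall_zero_iff, pi_norm_le_iff_of_nonneg (Real.sqrt_nonneg _)]
    intro i
    rw [Real.norm_eq_abs]
    refine Real.abs_le_sqrt (le_trans ?_ hxB)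
    exact Finset.single_le_sum (f := fun i => x i ^ 2) (fun i _ => sq_nonneg _)
      (Finset.mem_univ i)
  have hiff : ∀ x y : Fin m → ℝ,
        ((fun i => MvPolynomial.eval x (σ i) : Fin N → ℝ)
            = fun i => MvPolynomial.eval y (σ i))
          ↔ ∃ g ∈ K, g.mulVec x = y := by
    intro x y
    constructor
    · intro h
      by_contra hcon
      push Not at hcon
      let G : Subgroup (Matrix.orthogonalGroup (Fin m) ℝ) :=
        { carrier := {g | (g : Matrix (Fin m) (Fin m) ℝ) ∈ K}
          mul_mem' := fun {a b} ha hb => hKmul _ ha _ hb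
          one_mem' := hK1
          inv_mem' := fun {a} ha => by
            have h1 := hKinv _ ha
            have h2 : (a : Matrix (Fin m) (Fin m) ℝ)⁻¹ = ((a⁻¹ : Matrix.orthogonalGroup (Fin m) ℝ) :
                Matrix (Fin m) (Fin m) ℝ) := by
              refine Matrix.inv_eq_left_inv ?_
              exact congrArg Subtype.val (inv_mul_cancel a)
            rw [h2] at h1
            exact h1 }
      haveI : CompactSpace G := by
        refine isCompact_iff_compactSpace.mp ?_
        change IsCompact ((Subtype.val : Matrix.orthogonalGroup (Fin m) ℝ → _) ⁻¹' K)
        rw [Topology.IsInducing.subtypeVal.isCompact_preimage_iff]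
        · exact hKcpt
        · intro g hg
          exact ⟨⟨g, hKO g hg⟩, rfl⟩
      obtain ⟨P, hP, hne⟩ := hilbert_sep G x y (fun g hg => hcon g hg)
      obtain ⟨q, hq⟩ := hfac P (fun g hg z => hP ⟨g, hKO g hg⟩ hg z)
      exact hne (by rw [hq, hq, h])
    · rintro ⟨g, hg, rfl⟩
      funext i
      exact (hσinv i g hg x).symm
  refine ⟨hproper, hiff, fun F hF => ?_⟩
  have hFcomp : F ∘ Quot.mk _ = fun x : Fin m → ℝ =>
      (fun i => MvPolynomial.eval x (σ i) : Fin N → ℝ) := funext hF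
  refine Topology.IsClosedEmbedding.of_continuous_injective_isClosedMap ?_ ?_ ?_
  · rw [isQuotientMap_quot_mk.continuous_iff, hFcomp]
    exact hcont
  · rintro ⟨x⟩ ⟨y⟩ h
    change F (Quot.mk _ x) = F (Quot.mk _ y) at h
    rw [hF, hF] at h
    exact Quot.sound ((hiff x y).mp h)
  · intro C hC
    have h1 := hproper.isClosedMap _ (hC.preimage continuous_quot_mk)
    rw [← hFcomp, Set.image_comp, Set.image_preimage_eq _ Quot.mk_surjective] at h1
    exact h1
end

section
/- Let V be a real inner product space and G a subgroup of the group of linear isometric equivalences of V. Let x, y ∈ V satisfy ‖x − y‖ ≤ ‖x − g y‖ for all g ∈ G (so the segment from x to y realizes the distance between the orbits G·x and G·y). Let 0 < t < 1 and m = (1−t)·x + t·y. Then every h ∈ G with h m = m satisfies h x = x and h y = y; i.e. the isotropy group of any interior point of a minimal segment between two orbits is contained in the isotropy groups of both endpoints. -/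
/-- **Lemma 3.5** (Euclidean case): if the segment from `x` to `y` realizes the distance
between the orbits `G·x` and `G·y`, then the isotropy group of any interior point
`m = (1-t)x + ty` (`0 < t < 1`) is contained in the isotropy groups of both endpoints. -/
theorem isotropy_of_interior_point_of_minimal_segment
    {V : Type*} [NormedAddCommGroup V] [InnerProductSpace ℝ V]
    (G : Subgroup (V ≃ₗᵢ[ℝ] V))
    (x y : V)
    (hmin : ∀ g : G, ‖x - y‖ ≤ ‖x - (g : V ≃ₗᵢ[ℝ] V) y‖)
    (t : ℝ) (ht0 : 0 < t) (ht1 : t < 1) :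
    ∀ h : G, (h : V ≃ₗᵢ[ℝ] V) ((1 - t) • x + t • y) = (1 - t) • x + t • y →
      (h : V ≃ₗᵢ[ℝ] V) x = x ∧ (h : V ≃ₗᵢ[ℝ] V) y = y := by
  intro h hm
  have hle := hmin h
  generalize (h : V ≃ₗᵢ[ℝ] V) = f at hm hle ⊢
  set m := (1 - t) • x + t • y with hmdef
  have hx : x = m - t • (y - x) := by rw [hmdef]; module
  have hy : y = m + (1 - t) • (y - x) := by rw [hmdef]; module
  have hn : ‖f (y - x)‖ = ‖y - x‖ := f.norm_map _
  have hfx : f x = m - t • f (y - x) := by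
    conv_lhs => rw [hx]
    rw [map_sub, hm, map_smul]
  have hfy : f y = m + (1 - t) • f (y - x) := by
    conv_lhs => rw [hy]
    rw [map_add, hm, map_smul]
  have e1 : x - f y = -(t • (y - x) + (1 - t) • f (y - x)) := by
    rw [hfy, hmdef]; module
  rw [e1, norm_neg, norm_sub_rev] at hle
  have key : f (y - x) = y - x := by
    generalize f (y - x) = e at hn hle
    generalize y - x = d at hn hle
    have h1 : ‖d‖ ^ 2 ≤ ‖t • d + (1 - t) • e‖ ^ 2 := by gcongr
    have h2 := norm_sub_sq_real e d
    rw [norm_add_sq_real, norm_smul, norm_smul, inner_smul_left, inner_smul_right, mul_pow,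
      mul_pow, hn, Real.norm_eq_abs, Real.norm_eq_abs, sq_abs, sq_abs,
      real_inner_comm] at h1
    simp only [conj_trivial] at h1
    rw [hn] at h2
    have h3 : t * (1 - t) * ‖e - d‖ ^ 2 ≤ 0 := by
      rw [h2]; linarith
    have h4 : 0 < t * (1 - t) := mul_pos ht0 (by linarith)
    have h5 : ‖e - d‖ ^ 2 ≤ 0 := by
      by_contra hc
      push Not at hc
      exact absurd (mul_pos h4 hc) (not_lt.mpr h3)
    have h6 : ‖e - d‖ = 0 := pow_eq_zero_iff (two_ne_zero) |>.mp (le_antisymm h5 (sq_nonneg _))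
    exact sub_eq_zero.mp (norm_eq_zero.mp h6)
  rw [key] at hfx hfy
  exact ⟨hfx.trans hx.symm, hfy.trans hy.symm⟩
end

section
/- Let V be a finite-dimensional real inner product space and W a finite subgroup of the group of linear isometric equivalences of V that is generated by reflections (elements s ≠ id with s ∘ s = id whose fixed-point subspace {v : s v = v} is a hyperplane, i.e. has codimension 1). Let x, y ∈ V and suppose w₁, w₂ ∈ W both minimize w ↦ ‖x − w y‖ over W. Then there exists h ∈ W with h x = x and h (w₁ y) = w₂ y. Consequently, any two points of the orbit space V/W are connected by a unique minimal geodesic segment. -/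
open scoped InnerProductSpace NNReal

namespace ReflAux

variable {V : Type*} [NormedAddCommGroup V] [InnerProductSpace ℝ V]

/-- `r` is the reflection with unit root `a`. -/
def IsRefl (r : V ≃ₗᵢ[ℝ] V) (a : V) : Prop :=
  ‖a‖ = 1 ∧ ∀ v, r v = v - (2 * ⟪a, v⟫_ℝ) • a

/-- Unit roots of `W`. -/
def Root (W : Subgroup (V ≃ₗᵢ[ℝ] V)) (a : V) : Prop := ∃ r ∈ W, IsRefl r a

lemma IsRefl.self {r : V ≃ₗᵢ[ℝ] V} {a : V} (h : IsRefl r a) : r a = -a := by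
  rw [h.2, real_inner_self_eq_norm_sq, h.1]
  module

lemma IsRefl.app {r : V ≃ₗᵢ[ℝ] V} {a : V} (h : IsRefl r a) (v : V) : r (r v) = v := by
  conv_lhs => rw [h.2 v]
  rw [map_sub, map_smul, h.self, h.2 v]
  module

lemma IsRefl.mul_self {r : V ≃ₗᵢ[ℝ] V} {a : V} (h : IsRefl r a) : r * r = 1 := by
  ext v
  exact h.app v

lemma IsRefl.inv_eq {r : V ≃ₗᵢ[ℝ] V} {a : V} (h : IsRefl r a) : r⁻¹ = r :=
  inv_eq_of_mul_eq_one_left h.mul_self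

lemma IsRefl.conj {r : V ≃ₗᵢ[ℝ] V} {a : V} (h : IsRefl r a) (g : V ≃ₗᵢ[ℝ] V) :
    IsRefl (g * r * g⁻¹) (g a) := by
  refine ⟨by rw [g.norm_map]; exact h.1, fun v => ?_⟩
  obtain ⟨u, rfl⟩ := g.surjective v
  have e : (g * r * g⁻¹) (g u) = g (r u) := by
    change g (r (g.symm (g u))) = _
    rw [g.symm_apply_apply]
  rw [e, h.2, g.inner_map_map, map_sub, map_smul]

lemma IsRefl.uniq {r s : V ≃ₗᵢ[ℝ] V} {a : V} (h : IsRefl r a) (h' : IsRefl s a) : r = s := by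
  ext v
  rw [h.2, h'.2]

lemma IsRefl.neg {r : V ≃ₗᵢ[ℝ] V} {a : V} (h : IsRefl r a) : IsRefl r (-a) := by
  refine ⟨by rw [norm_neg]; exact h.1, fun v => ?_⟩
  rw [h.2, inner_neg_left]
  module

lemma Root.neg {W : Subgroup (V ≃ₗᵢ[ℝ] V)} {a : V} (h : Root W a) : Root W (-a) := by
  obtain ⟨r, hr, h⟩ := h
  exact ⟨r, hr, h.neg⟩

lemma Root.map {W : Subgroup (V ≃ₗᵢ[ℝ] V)} {a : V} (h : Root W a) {g : V ≃ₗᵢ[ℝ] V}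
    (hg : g ∈ W) : Root W (g a) := by
  obtain ⟨r, hr, h⟩ := h
  exact ⟨_, W.mul_mem (W.mul_mem hg hr) (W.inv_mem hg), h.conj g⟩

lemma root_finite (W : Subgroup (V ≃ₗᵢ[ℝ] V)) (hW : (W : Set (V ≃ₗᵢ[ℝ] V)).Finite) :
    {a | Root W a}.Finite := by
  have : {a | Root W a} = ⋃ r ∈ (W : Set (V ≃ₗᵢ[ℝ] V)), {a | IsRefl r a} := by
    ext a; simp [Root]
  rw [this]
  refine hW.biUnion fun r _ => ?_
  by_cases hne : ∃ a, IsRefl r a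
  · obtain ⟨a, ha⟩ := hne
    refine (Set.toFinite {a, -a}).subset fun b hb => ?_
    have hb : IsRefl r b := hb
    have e := ha.2 b
    rw [hb.self] at e
    have e2 : b = ⟪a, b⟫_ℝ • a := by
      have : (2:ℝ) • b = (2:ℝ) • (⟪a, b⟫_ℝ • a) := by
        rw [smul_smul, two_smul]
        have h3 := congrArg (fun t => b + b + t) e
        have h4 : (2 * ⟪a, b⟫_ℝ) • a = b + b := by
          rw [← sub_eq_zero, ← sub_eq_zero.mpr e]; module
        exact h4.symm
      exact smul_right_injective V (two_ne_zero (α := ℝ)) this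
    have e3 := congrArg norm e2
    rw [norm_smul, ha.1, hb.1, mul_one, Real.norm_eq_abs] at e3
    rcases eq_or_eq_neg_of_abs_eq e3.symm with h | h <;> rw [h] at e2 <;> simp at e2 <;> simp [e2]
  · push Not at hne
    convert Set.finite_empty
    ext a; simp [hne a]

/-- A generator of the reflection group is a reflection in a unit root. -/
lemma exists_root [FiniteDimensional ℝ V] (s : V ≃ₗᵢ[ℝ] V) (hs : s * s = 1)
    (hf : Module.finrank ℝ
          (LinearMap.ker ((s.toLinearEquiv : V →ₗ[ℝ] V) - LinearMap.id)) + 1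
        = Module.finrank ℝ V) : ∃ a, IsRefl s a := by
  set K := LinearMap.ker ((s.toLinearEquiv : V →ₗ[ℝ] V) - LinearMap.id) with hK
  have memK : ∀ v, v ∈ K ↔ s v = v := by
    intro v
    simp [hK, LinearMap.mem_ker, sub_eq_zero]
  have h1 : Module.finrank ℝ Kᗮ = 1 := by
    have := K.finrank_add_finrank_orthogonal
    omega
  obtain ⟨⟨a0, ha0⟩, hne, hgen⟩ := finrank_eq_one_iff'.mp h1
  have ha0' : a0 ≠ 0 := fun h => hne (by ext; simpa using h)
  have hn : ‖a0‖ ≠ 0 := norm_ne_zero_iff.mpr ha0'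
  have hgen' : ∀ v ∈ Kᗮ, ∃ t : ℝ, v = t • a0 := by
    intro v hv
    obtain ⟨t, ht⟩ := hgen ⟨v, hv⟩
    exact ⟨t, by simpa using (congrArg Subtype.val ht).symm⟩
  have hss : ∀ v, s (s v) = v := fun v => by
    have := congrArg (fun f : V ≃ₗᵢ[ℝ] V => f v) hs
    exact this
  have hsa : s a0 - a0 ∈ Kᗮ := by
    rw [Submodule.mem_orthogonal]
    intro k hk
    have e := s.inner_map_map k a0
    rw [(memK k).1 hk] at e
    rw [inner_sub_right, e, sub_self]
  have hadd : a0 + s a0 = 0 := by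
    have hk : a0 + s a0 ∈ K := by rw [memK, map_add, hss, add_comm]
    have hk' : a0 + s a0 ∈ Kᗮ := by
      have : a0 + s a0 = (s a0 - a0) + (2:ℝ) • a0 := by module
      rw [this]
      exact Kᗮ.add_mem hsa (Kᗮ.smul_mem _ ha0)
    have := (Submodule.mem_orthogonal _ _).1 hk' _ hk
    exact inner_self_eq_zero.1 this
  have hsa0 : s a0 = -a0 := (neg_eq_of_add_eq_zero_right hadd).symm
  refine ⟨‖a0‖⁻¹ • a0, by rw [norm_smul, norm_inv, norm_norm, inv_mul_cancel₀ hn], fun v => ?_⟩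
  obtain ⟨k, hk, z, hz, rfl⟩ := K.exists_add_mem_mem_orthogonal v
  obtain ⟨t, rfl⟩ := hgen' z hz
  have hin : ⟪a0, k⟫_ℝ = 0 := (Submodule.mem_orthogonal' _ _).1 ha0 k hk
  rw [map_add, (memK k).1 hk, map_smul, hsa0, inner_add_right, inner_smul_left, inner_smul_left,
    inner_smul_right, hin, real_inner_self_eq_norm_sq, smul_smul]
  have : (2 * ((starRingEnd ℝ) ‖a0‖⁻¹ * 0 + (starRingEnd ℝ) ‖a0‖⁻¹ * (t * ‖a0‖ ^ 2))) * ‖a0‖⁻¹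
      = 2 * t := by
    simp only [conj_trivial]
    field_simp
    ring
  rw [this]
  module

lemma span_pos {D : Set V} {c : V} (hD : ∀ a ∈ D, 0 < ⟪a, c⟫_ℝ) {m : V}
    (hm : m ∈ Submodule.span ℝ≥0 D) : m = 0 ∨ 0 < ⟪m, c⟫_ℝ := by
  induction hm using Submodule.span_induction with
  | mem x h => exact Or.inr (hD x h)
  | zero => exact Or.inl rfl
  | add x y _ _ hx hy =>
    rcases hx with rfl | hx
    · simpa using hy
    · rcases hy with rfl | hy
      · right; simpa using hx
      · right; rw [inner_add_left]; positivity
  | smul t x _ hx =>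
    rcases hx with rfl | hx
    · left; simp
    · rcases eq_or_ne t 0 with rfl | ht
      · left; simp
      · right
        rw [NNReal.smul_def, inner_smul_left]
        have : 0 < (t : ℝ) := by positivity
        simpa using mul_pos this hx

lemma span_nonneg {D : Set V} {u : V} (hD : ∀ a ∈ D, 0 ≤ ⟪a, u⟫_ℝ) {m : V}
    (hm : m ∈ Submodule.span ℝ≥0 D) : 0 ≤ ⟪m, u⟫_ℝ := by
  induction hm using Submodule.span_induction with
  | mem x h => exact hD x h
  | zero => simp
  | add x y _ _ hx hy => rw [inner_add_left]; positivity
  | smul t x _ hx =>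
    rw [NNReal.smul_def, inner_smul_left]
    simpa using mul_nonneg t.2 hx

/-- Simple systems. -/
structure Simple (W : Subgroup (V ≃ₗᵢ[ℝ] V)) (c : V) (D : Set V) : Prop where
  reg : ∀ a, Root W a → ⟪a, c⟫_ℝ ≠ 0
  root : ∀ a ∈ D, Root W a
  pos : ∀ a ∈ D, 0 < ⟪a, c⟫_ℝ
  span : ∀ b, Root W b → 0 < ⟪b, c⟫_ℝ → b ∈ Submodule.span ℝ≥0 D
  indep : ∀ a ∈ D, a ∉ Submodule.span ℝ≥0 (D \ {a})

lemma exists_simple (W : Subgroup (V ≃ₗᵢ[ℝ] V)) (hW : (W : Set (V ≃ₗᵢ[ℝ] V)).Finite) (c : V)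
    (hc : ∀ a, Root W a → ⟪a, c⟫_ℝ ≠ 0) : ∃ D, Simple W c D := by
  set P : Set V := {a | Root W a ∧ 0 < ⟪a, c⟫_ℝ} with hP
  have hPf : P.Finite := (root_finite W hW).subset fun a h => h.1
  have hF : {D : Set V | D ⊆ P ∧ P ⊆ Submodule.span ℝ≥0 D}.Finite :=
    hPf.finite_subsets.subset fun D h => h.1
  obtain ⟨D, hD⟩ := hF.exists_minimal ⟨P, Set.Subset.rfl, Submodule.subset_span⟩
  refine ⟨D, hc, fun a ha => (hD.1.1 ha).1, fun a ha => (hD.1.1 ha).2,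
    fun b hb hb' => hD.1.2 ⟨hb, hb'⟩, fun a ha hsp => ?_⟩
  have hle : Submodule.span ℝ≥0 D ≤ Submodule.span ℝ≥0 (D \ {a}) := by
    rw [Submodule.span_le]
    intro b hb
    by_cases h : b = a
    · rw [h]; exact hsp
    · exact Submodule.subset_span ⟨hb, h⟩
  have := hD.2 (y := D \ {a}) ⟨fun b hb => hD.1.1 hb.1, fun b hb => hle (hD.1.2 hb)⟩
    Set.sdiff_subset
  exact (this ha).2 rfl

lemma Simple.perm {W : Subgroup (V ≃ₗᵢ[ℝ] V)} {c : V} {D : Set V} (h : Simple W c D)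
    {a b : V} (ha : a ∈ D) (hb : Root W b) (hbc : 0 < ⟪b, c⟫_ℝ) (hne : b ≠ a)
    {r : V ≃ₗᵢ[ℝ] V} (hr : IsRefl r a) : 0 < ⟪r b, c⟫_ℝ := by
  have hrW : r ∈ W := by
    obtain ⟨s, hs, hs'⟩ := h.root a ha
    rwa [hr.uniq hs']
  by_contra hcon
  have hneg : 0 < ⟪-(r b), c⟫_ℝ := by
    rw [inner_neg_left]
    have := h.reg _ (hb.map hrW)
    have : ⟪r b, c⟫_ℝ < 0 := lt_of_le_of_ne (not_lt.1 hcon) this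
    linarith
  have hD : D = insert a (D \ {a}) := by simp [Set.insert_eq_of_mem ha]
  have m1 := h.span b hb hbc
  have m2 := h.span _ (hb.map hrW).neg hneg
  rw [hD, Submodule.mem_span_insert] at m1 m2
  obtain ⟨t, m, hm, e1⟩ := m1
  obtain ⟨t', m', hm', e2⟩ := m2
  have hDp : ∀ x ∈ D \ {a}, 0 < ⟪x, c⟫_ℝ := fun x hx => h.pos x hx.1
  rw [NNReal.smul_def] at e1 e2
  rw [hr.2] at e2
  have hm0 : m ≠ 0 := by
    rintro rfl
    apply hne
    have hn : ‖b‖ = 1 := by obtain ⟨s, _, hs⟩ := hb; exact hs.1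
    rw [add_zero] at e1
    rw [e1, norm_smul, hr.1, mul_one] at hn
    have : (t : ℝ) = 1 := by simpa using hn
    rw [e1, this, one_smul]
  have hmp : 0 < ⟪m, c⟫_ℝ := (span_pos hDp hm).resolve_left hm0
  have hmp' : 0 ≤ ⟪m', c⟫_ℝ := span_nonneg (fun x hx => (hDp x hx).le) hm'
  have key : (2 * ⟪a, b⟫_ℝ - t - t') • a = m + m' := by
    have : m' = -(b - (2 * ⟪a, b⟫_ℝ) • a) - (t' : ℝ) • a := by rw [e2]; module
    have h2 : m = b - (t : ℝ) • a := by rw [e1]; module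
    rw [this, h2]
    module
  set l := 2 * ⟪a, b⟫_ℝ - t - t' with hl
  have hlpos : 0 < l := by
    have e := congrArg (fun z => ⟪z, c⟫_ℝ) key
    simp only [inner_smul_left, inner_add_left, conj_trivial] at e
    have := h.pos a ha
    by_contra hh
    nlinarith [not_lt.1 hh]
  apply h.indep a ha
  have hcoe : ((l⁻¹.toNNReal : ℝ≥0) : ℝ) = l⁻¹ := Real.coe_toNNReal _ (by positivity)
  have e : l⁻¹.toNNReal • (m + m') = a := by
    rw [NNReal.smul_def, hcoe, ← key, smul_smul, inv_mul_cancel₀ hlpos.ne', one_smul]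
  have hmem := Submodule.smul_mem _ l⁻¹.toNNReal (Submodule.add_mem _ hm hm')
  rwa [e] at hmem

/-- Words of length `n` in simple reflections. -/
inductive Wd (D : Set V) : ℕ → (V ≃ₗᵢ[ℝ] V) → Prop
  | nil : Wd D 0 1
  | cons {n : ℕ} {r g : V ≃ₗᵢ[ℝ] V} {a : V} : a ∈ D → IsRefl r a → Wd D n g → Wd D (n + 1) (r * g)

lemma Simple.refl_mem {W : Subgroup (V ≃ₗᵢ[ℝ] V)} {c : V} {D : Set V} (h : Simple W c D)
    {a : V} (ha : a ∈ D) {r : V ≃ₗᵢ[ℝ] V} (hr : IsRefl r a) : r ∈ W := by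
  obtain ⟨s, hs, hs'⟩ := h.root a ha
  rwa [hr.uniq hs']

lemma Simple.exchange {W : Subgroup (V ≃ₗᵢ[ℝ] V)} {c : V} {D : Set V} (h : Simple W c D)
    {n : ℕ} {g : V ≃ₗᵢ[ℝ] V} (hg : Wd D n g) : ∀ {a : V} {r : V ≃ₗᵢ[ℝ] V}, Root W a →
    IsRefl r a → 0 < ⟪a, c⟫_ℝ → ⟪g⁻¹ a, c⟫_ℝ < 0 → ∃ m, m < n ∧ Wd D m (r * g) := by
  induction hg with
  | nil =>
    intro a r _ _ h1 h2
    simp at h2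
    linarith
  | @cons n s g b hb hs hg ih =>
    intro a r ha hr h1 h2
    by_cases hab : a = b
    · subst hab
      refine ⟨n, by omega, ?_⟩
      rw [hr.uniq hs, ← mul_assoc, hs.mul_self, one_mul]
      exact hg
    · have hpos := h.perm hb ha h1 hab hs
      have hc := hr.conj s
      rw [hs.inv_eq] at hc
      have h2' : ⟪g⁻¹ (s a), c⟫_ℝ < 0 := by
        rw [mul_inv_rev, hs.inv_eq] at h2
        exact h2
      obtain ⟨m, hm, hw⟩ := ih (ha.map (h.refl_mem hb hs)) hc hpos h2'
      refine ⟨m + 1, by omega, ?_⟩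
      have e : r * (s * g) = s * (s * r * s * g) := by
        simp only [mul_assoc]
        rw [← mul_assoc s s, hs.mul_self, one_mul]
      rw [e]
      exact Wd.cons hb hs hw

lemma Simple.fund {W : Subgroup (V ≃ₗᵢ[ℝ] V)} {c : V} {D : Set V} (h : Simple W c D)
    {u v : V} (hu : ∀ a, Root W a → 0 < ⟪a, c⟫_ℝ → 0 ≤ ⟪a, u⟫_ℝ)
    (hv : ∀ a, Root W a → 0 < ⟪a, c⟫_ℝ → 0 ≤ ⟪a, v⟫_ℝ) (n : ℕ) :
    ∀ g, Wd D n g → g ∈ W → g u = v → u = v := by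
  induction n using Nat.strong_induction_on with
  | _ n ih =>
    intro g hg hgW hguv
    cases hg with
    | nil => exact hguv
    | @cons n r g a ha hr hg =>
      have hrW := h.refl_mem ha hr
      have hg' : g ∈ W := by
        have := W.mul_mem (W.inv_mem hrW) hgW
        simpa using this
      have hguv' : r (g u) = v := hguv
      have hroot : Root W (g⁻¹ a) := (h.root a ha).map (W.inv_mem hg')
      have hin : ⟪g⁻¹ a, u⟫_ℝ = ⟪a, g u⟫_ℝ := by
        rw [← g.inner_map_map]
        congr 1
        exact g.apply_symm_apply a
      rcases lt_or_gt_of_ne (h.reg _ hroot) with hlt | hgt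
      · obtain ⟨m, hm, hw⟩ := h.exchange hg (h.root a ha) hr (h.pos a ha) hlt
        exact ih m (by omega) _ hw hgW hguv
      · have h1 := hu _ hroot hgt
        rw [hin] at h1
        have h2 := hv a (h.root a ha) (h.pos a ha)
        rw [← hguv', ← r.inner_map_map, hr.app, hr.self, inner_neg_left] at h2
        have h0 : ⟪a, g u⟫_ℝ = 0 := by linarith
        rw [hr.2, h0] at hguv'
        exact ih n (by omega) g hg hg' (by simpa using hguv')

lemma Simple.gen {W : Subgroup (V ≃ₗᵢ[ℝ] V)} (hW : (W : Set (V ≃ₗᵢ[ℝ] V)).Finite)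
    {c : V} {D : Set V} (h : Simple W c D) {b : V} (hb : Root W b) {s : V ≃ₗᵢ[ℝ] V}
    (hs : IsRefl s b) : s ∈ Subgroup.closure {r | ∃ a ∈ D, IsRefl r a} := by
  set G := Subgroup.closure {r : V ≃ₗᵢ[ℝ] V | ∃ a ∈ D, IsRefl r a} with hG
  have hGW : G ≤ W := by
    rw [hG, Subgroup.closure_le]
    rintro r ⟨a, ha, hr⟩
    exact h.refl_mem ha hr
  wlog hpos : 0 < ⟪b, c⟫_ℝ generalizing b
  · refine this hb.neg hs.neg ?_
    have := lt_of_le_of_ne (not_lt.1 hpos) (h.reg b hb)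
    rw [inner_neg_left]; linarith
  set Q : Set V := {x | Root W x ∧ 0 < ⟪x, c⟫_ℝ ∧ ∃ g ∈ G, x = g b} with hQ
  have hQf : Q.Finite := (root_finite W hW).subset fun a h => h.1
  obtain ⟨x, ⟨hx, hxc, g, hg, hxg⟩, hmin⟩ := Set.exists_min_image Q (fun x => ⟪x, c⟫_ℝ) hQf
    ⟨b, hb, hpos, 1, G.one_mem, rfl⟩
  have hxD : x ∈ D := by
    by_contra hxD
    have hle : ∀ a ∈ D, 0 ≤ ⟪a, -x⟫_ℝ := by
      intro a ha
      by_contra hneg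
      obtain ⟨r, hrW, hr⟩ := h.root a ha
      have hp := h.perm ha hx hxc (fun e => hxD (e ▸ ha)) hr
      have := hmin (r x) ⟨hx.map hrW, hp, r * g,
        G.mul_mem (Subgroup.subset_closure ⟨a, ha, hr⟩) hg, by rw [hxg]; rfl⟩
      simp only [hr.2, inner_sub_left, inner_smul_left, conj_trivial] at this
      rw [inner_neg_right] at hneg
      have := h.pos a ha
      nlinarith
    have h1 := span_nonneg hle (h.span x hx hxc)
    obtain ⟨r, _, hr⟩ := hx
    rw [inner_neg_right, real_inner_self_eq_norm_sq, hr.1] at h1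
    norm_num at h1
  have hc := hs.conj g
  rw [← hxg] at hc
  have : g * s * g⁻¹ ∈ G := Subgroup.subset_closure ⟨x, hxD, hc⟩
  have := G.mul_mem (G.mul_mem (G.inv_mem hg) this) hg
  simpa [mul_assoc] using this

lemma wd_of_closure {D : Set V} {g : V ≃ₗᵢ[ℝ] V}
    (hg : g ∈ Subgroup.closure {r : V ≃ₗᵢ[ℝ] V | ∃ a ∈ D, IsRefl r a}) : ∃ n, Wd D n g := by
  induction hg using Subgroup.closure_induction_left with
  | one => exact ⟨0, Wd.nil⟩
  | mul_left x hx y _ ih =>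
    obtain ⟨a, ha, hr⟩ := hx
    obtain ⟨n, hn⟩ := ih
    exact ⟨n + 1, Wd.cons ha hr hn⟩
  | inv_mul_cancel x hx y _ ih =>
    obtain ⟨a, ha, hr⟩ := hx
    obtain ⟨n, hn⟩ := ih
    rw [hr.inv_eq]
    exact ⟨n + 1, Wd.cons ha hr hn⟩

/-- Finitely many nonzero vectors admit a common non-orthogonal vector. -/
lemma exists_generic {F : Set V} (hF : F.Finite) (h0 : ∀ a ∈ F, a ≠ 0) :
    ∃ p : V, ∀ a ∈ F, ⟪a, p⟫_ℝ ≠ 0 := by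
  induction F, hF using Set.Finite.induction_on with
  | empty => exact ⟨0, by simp⟩
  | @insert a F _ hF ih =>
    obtain ⟨p, hp⟩ := ih fun b hb => h0 b (Set.mem_insert_of_mem _ hb)
    have ha : ⟪a, a⟫_ℝ ≠ 0 := inner_self_ne_zero.2 (h0 a (Set.mem_insert _ _))
    obtain ⟨t, ht⟩ := (((hF.insert a).image
      fun b => -⟪b, p⟫_ℝ / ⟪b, a⟫_ℝ).union (Set.finite_singleton 0)).infinite_compl.nonempty
    refine ⟨p + t • a, fun b hb => ?_⟩
    simp only [Set.mem_compl_iff, Set.mem_union, not_or, Set.mem_singleton_iff] at ht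
    rw [inner_add_right, inner_smul_right]
    by_cases hba : ⟪b, a⟫_ℝ = 0
    · rcases hb with rfl | hb
      · exact absurd hba ha
      · simpa [hba] using hp b hb
    · intro e
      apply ht.1
      refine ⟨b, hb, ?_⟩
      rw [div_eq_iff hba]
      linarith

lemma exists_near {F : Set V} (hF : F.Finite) (h0 : ∀ a ∈ F, a ≠ 0) (q : V) :
    ∃ c : V, ∀ a ∈ F, ⟪a, c⟫_ℝ ≠ 0 ∧ (⟪a, q⟫_ℝ = 0 ∨ 0 < ⟪a, q⟫_ℝ * ⟪a, c⟫_ℝ) := by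
  obtain ⟨p, hp⟩ := exists_generic hF h0
  obtain ⟨N, hN⟩ := (hF.image fun a => |⟪a, p⟫_ℝ| / |⟪a, q⟫_ℝ|).bddAbove
  refine ⟨p + (|N| + 1) • q, fun a ha => ?_⟩
  rw [inner_add_right, inner_smul_right]
  by_cases hq : ⟪a, q⟫_ℝ = 0
  · simp [hq, hp a ha]
  · have h1 : |⟪a, p⟫_ℝ| / |⟪a, q⟫_ℝ| ≤ N := hN ⟨a, ha, rfl⟩
    have hq' : 0 < |⟪a, q⟫_ℝ| := abs_pos.2 hq
    rw [div_le_iff₀ hq'] at h1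
    have h2 := le_abs_self N
    have h3 : |⟪a, p⟫_ℝ| < (|N| + 1) * |⟪a, q⟫_ℝ| := by nlinarith
    have key : 0 < ⟪a, q⟫_ℝ * (⟪a, p⟫_ℝ + (|N| + 1) * ⟪a, q⟫_ℝ) := by
      have h4 : -(|⟪a, q⟫_ℝ| * |⟪a, p⟫_ℝ|) ≤ ⟪a, q⟫_ℝ * ⟪a, p⟫_ℝ := by
        rw [← abs_mul]; exact neg_abs_le _
      have h5 : ⟪a, q⟫_ℝ * ⟪a, q⟫_ℝ = |⟪a, q⟫_ℝ| * |⟪a, q⟫_ℝ| := (abs_mul_abs_self _).symm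
      have h6 := mul_lt_mul_of_pos_left h3 hq'
      have h7 : |⟪a, q⟫_ℝ| * ((|N| + 1) * |⟪a, q⟫_ℝ|) = (|N| + 1) * (⟪a, q⟫_ℝ * ⟪a, q⟫_ℝ) := by
        rw [h5]; ring
      have h8 : ⟪a, q⟫_ℝ * (⟪a, p⟫_ℝ + (|N| + 1) * ⟪a, q⟫_ℝ)
          = ⟪a, q⟫_ℝ * ⟪a, p⟫_ℝ + (|N| + 1) * (⟪a, q⟫_ℝ * ⟪a, q⟫_ℝ) := by ring
      rw [h8]
      linarith
    exact ⟨fun e => by rw [e] at key; simp at key, Or.inr key⟩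

lemma fund_domain (W : Subgroup (V ≃ₗᵢ[ℝ] V)) (hW : (W : Set (V ≃ₗᵢ[ℝ] V)).Finite)
    (S : Set (V ≃ₗᵢ[ℝ] V)) (hS : ∀ s ∈ S, ∃ a, IsRefl s a) (hgen : Subgroup.closure S = W)
    {u v : V} (huv : ∀ a, Root W a → 0 ≤ ⟪a, u⟫_ℝ * ⟪a, v⟫_ℝ) {g : V ≃ₗᵢ[ℝ] V} (hg : g ∈ W)
    (hguv : g u = v) : u = v := by
  obtain ⟨c, hc⟩ := exists_near (root_finite W hW) (fun a ha => by
    obtain ⟨r, _, hr⟩ := ha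
    intro h0
    have := hr.1
    simp [h0] at this) (u + v)
  obtain ⟨D, hD⟩ := exists_simple W hW c fun a ha => (hc a ha).1
  have hW' : W ≤ Subgroup.closure {r : V ≃ₗᵢ[ℝ] V | ∃ a ∈ D, IsRefl r a} := by
    rw [← hgen, Subgroup.closure_le]
    intro s hs
    obtain ⟨a, ha⟩ := hS s hs
    exact hD.gen hW ⟨s, hgen ▸ Subgroup.subset_closure hs, ha⟩ ha
  obtain ⟨n, hn⟩ := wd_of_closure (hW' hg)
  have hboth : ∀ a, Root W a → 0 < ⟪a, c⟫_ℝ → 0 ≤ ⟪a, u⟫_ℝ ∧ 0 ≤ ⟪a, v⟫_ℝ := by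
    intro a ha hac
    have h1 := huv a ha
    have h2 : 0 ≤ ⟪a, u⟫_ℝ + ⟪a, v⟫_ℝ := by
      rw [← inner_add_right]
      rcases (hc a ha).2 with h | h
      · exact h.ge
      · exact (pos_of_mul_pos_left h hac.le).le
    constructor <;> by_contra hh <;> nlinarith [not_le.1 hh]
  exact hD.fund (fun a ha h => (hboth a ha h).1) (fun a ha h => (hboth a ha h).2) n g hn hg hguv

lemma inner_le_of_norm {x y z : V} (h : ‖y‖ = ‖z‖) (hle : ‖x - y‖ ≤ ‖x - z‖) :
    ⟪x, z⟫_ℝ ≤ ⟪x, y⟫_ℝ := by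
  have h1 := norm_sub_sq_real x y
  have h2 := norm_sub_sq_real x z
  have h3 : ‖x - y‖ ^ 2 ≤ ‖x - z‖ ^ 2 := by gcongr
  rw [h] at h1
  linarith

lemma root_nonneg {x z a : V} {r : V ≃ₗᵢ[ℝ] V} (hr : IsRefl r a)
    (h : ⟪x, r z⟫_ℝ ≤ ⟪x, z⟫_ℝ) : 0 ≤ ⟪a, x⟫_ℝ * ⟪a, z⟫_ℝ := by
  rw [hr.2, inner_sub_right, inner_smul_right, real_inner_comm a x] at h
  nlinarith

end ReflAux

/-- **Proposition 3.2** (reflection-group form): if `W` is a finite reflection group on a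
finite-dimensional real inner product space and `w₁, w₂ ∈ W` both minimize
`w ↦ ‖x - w y‖`, then some `h ∈ W` fixes `x` and maps `w₁ y` to `w₂ y`; consequently any
two points of `V/W` are joined by a unique minimal geodesic segment. -/
theorem reflection_group_minimizers_conjugate_by_isotropy
    {V : Type*} [NormedAddCommGroup V] [InnerProductSpace ℝ V] [FiniteDimensional ℝ V]
    (W : Subgroup (V ≃ₗᵢ[ℝ] V))
    (hWfin : (W : Set (V ≃ₗᵢ[ℝ] V)).Finite)
    (S : Set (V ≃ₗᵢ[ℝ] V))
    (hSrefl : ∀ s ∈ S, s ≠ 1 ∧ s * s = 1 ∧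
      Module.finrank ℝ
          (LinearMap.ker ((s.toLinearEquiv : V →ₗ[ℝ] V) - LinearMap.id)) + 1
        = Module.finrank ℝ V)
    (hSgen : Subgroup.closure S = W)
    (x y : V) (w₁ w₂ : W)
    (h₁ : ∀ w : W, ‖x - (w₁ : V ≃ₗᵢ[ℝ] V) y‖ ≤ ‖x - (w : V ≃ₗᵢ[ℝ] V) y‖)
    (h₂ : ∀ w : W, ‖x - (w₂ : V ≃ₗᵢ[ℝ] V) y‖ ≤ ‖x - (w : V ≃ₗᵢ[ℝ] V) y‖) :
    ∃ h : W, (h : V ≃ₗᵢ[ℝ] V) x = x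
      ∧ (h : V ≃ₗᵢ[ℝ] V) ((w₁ : V ≃ₗᵢ[ℝ] V) y) = (w₂ : V ≃ₗᵢ[ℝ] V) y := by
  classical
  have hS : ∀ s ∈ S, ∃ a, ReflAux.IsRefl s a := fun s hs =>
    ReflAux.exists_root s (hSrefl s hs).2.1 (hSrefl s hs).2.2
  set z₁ : V := (w₁ : V ≃ₗᵢ[ℝ] V) y with hz₁
  set z₂ : V := (w₂ : V ≃ₗᵢ[ℝ] V) y with hz₂
  have m₁ : ∀ g ∈ W, inner ℝ x (g z₁) ≤ inner ℝ x z₁ := fun g hg =>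
    ReflAux.inner_le_of_norm (g.norm_map z₁).symm (h₁ ((⟨g, hg⟩ : W) * w₁))
  have m₂ : ∀ g ∈ W, inner ℝ x (g z₂) ≤ inner ℝ x z₂ := fun g hg =>
    ReflAux.inner_le_of_norm (g.norm_map z₂).symm (h₂ ((⟨g, hg⟩ : W) * w₂))
  obtain ⟨h, ⟨hW, hx⟩, hmax⟩ := Set.exists_max_image {g : V ≃ₗᵢ[ℝ] V | g ∈ W ∧ g x = x}
    (fun g => inner ℝ z₂ (g z₁)) (hWfin.subset fun g hg => hg.1) ⟨1, W.one_mem, rfl⟩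
  refine ⟨⟨h, hW⟩, hx, ?_⟩
  change h z₁ = z₂
  have hxz : inner ℝ x (h z₁) = inner ℝ x z₁ := by
    conv_lhs => rw [← hx]
    exact h.inner_map_map x z₁
  refine ReflAux.fund_domain W hWfin S hS hSgen (g := w₂ * (w₁ : V ≃ₗᵢ[ℝ] V)⁻¹ * h⁻¹) ?_
    (W.mul_mem (W.mul_mem w₂.2 (W.inv_mem w₁.2)) (W.inv_mem hW)) ?_
  · rintro a ⟨r, hrW, hr⟩
    have p1 : 0 ≤ inner ℝ a x * inner ℝ a (h z₁) :=
      ReflAux.root_nonneg hr (by rw [hxz]; exact m₁ (r * h) (W.mul_mem hrW hW))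
    have p2 : 0 ≤ inner ℝ a x * inner ℝ a z₂ := ReflAux.root_nonneg hr (m₂ r hrW)
    by_cases h0 : inner ℝ a x = 0
    · have hrx : r x = x := by rw [hr.2, h0]; simp
      have := ReflAux.root_nonneg hr (hmax (r * h) ⟨W.mul_mem hrW hW, by
        change r (h x) = x
        rw [hx, hrx]⟩)
      rw [mul_comm]
      exact this
    · have hsq : 0 < inner ℝ a x * inner ℝ a x := mul_self_pos.2 h0
      have := mul_nonneg p1 p2
      have e : inner ℝ a x * inner ℝ a (h z₁) * (inner ℝ a x * inner ℝ a z₂)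
        = (inner ℝ a x * inner ℝ a x) * (inner ℝ a (h z₁) * inner ℝ a z₂) := by ring
      rw [e] at this
      exact nonneg_of_mul_nonneg_right this hsq
  · change (w₂ : V ≃ₗᵢ[ℝ] V) ((w₁ : V ≃ₗᵢ[ℝ] V).symm (h.symm (h z₁))) = z₂
    rw [h.symm_apply_apply, hz₁, LinearIsometryEquiv.symm_apply_apply]
end

section
/- Let n ≥ 1, let a : Fin n → ℝ, let A = diagonal(a) be the real diagonal n×n matrix with entries a_i (viewed as a complex matrix), and let α be a Hermitian n×n complex matrix (αᴴ = α). Suppose c ∈ ℝ and w : Fin n → ℂ with w ≠ 0 satisfy [A,α] = i·(c·1 + w wᴴ), where [A,α] = Aα − αA, 1 is the identity matrix, and (w wᴴ)_{ij} = w_i · conj(w_j). Then |w_i|² = −c for every i (so c < 0), and the entries of a are pairwise distinct: a_i ≠ a_j whenever i ≠ j. -/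
open Matrix

/-- **Section 5.7**: if the momentum `[A,α]` of a diagonal matrix `A = diagonal a` and a
Hermitian matrix `α` equals `i(c·1 + w wᴴ)` with `w ≠ 0`, then `|wᵢ|² = -c` for all `i`
(so `c < 0`) and the diagonal entries of `A` are pairwise distinct (`A` is regular). -/
theorem rank_one_momentum_forces_regular
    (n : ℕ) (hn : 1 ≤ n) (a : Fin n → ℝ)
    (α : Matrix (Fin n) (Fin n) ℂ) (hα : α.IsHermitian)
    (c : ℝ) (w : Fin n → ℂ) (hw : w ≠ 0)
    (hY : Matrix.diagonal (fun i => (a i : ℂ)) * α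
          - α * Matrix.diagonal (fun i => (a i : ℂ))
        = Complex.I • ((c : ℂ) • (1 : Matrix (Fin n) (Fin n) ℂ)
            + Matrix.vecMulVec w (star w))) :
    (∀ i, ‖w i‖ ^ 2 = -c) ∧ c < 0 ∧ ∀ i j, i ≠ j → a i ≠ a j := by
  have key : ∀ i j, (a i : ℂ) * α i j - α i j * (a j : ℂ)
      = Complex.I * ((c : ℂ) * (1 : Matrix (Fin n) (Fin n) ℂ) i j + w i * star (w j)) := by
    intro i j
    have h := congrFun (congrFun hY i) j
    simpa only [Matrix.sub_apply, Matrix.diagonal_mul, Matrix.mul_diagonal, Matrix.smul_apply,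
      Matrix.add_apply, Matrix.vecMulVec_apply, Pi.star_apply, smul_eq_mul] using h
  have h1 : ∀ i, ‖w i‖ ^ 2 = -c := by
    intro i
    have h := key i i
    rw [mul_comm (α i i), sub_self, Matrix.one_apply_eq, mul_one] at h
    have h2 := (mul_eq_zero.mp h.symm).resolve_left Complex.I_ne_zero
    have h3 : w i * star (w i) = ((‖w i‖ ^ 2 : ℝ) : ℂ) := by
      rw [Complex.ofReal_pow]
      exact Complex.mul_conj' (w i)
    rw [h3, ← Complex.ofReal_add] at h2
    have h4 : c + ‖w i‖ ^ 2 = 0 := by exact_mod_cast h2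
    linarith
  obtain ⟨k, hk⟩ := Function.ne_iff.mp hw
  have hc : c < 0 := by
    have h2 : 0 < ‖w k‖ ^ 2 := pow_pos (norm_pos_iff.mpr hk) 2
    linarith [h1 k]
  have hne : ∀ i, w i ≠ 0 := by
    intro i h0
    have h2 := h1 i
    rw [h0, norm_zero] at h2
    linarith
  refine ⟨h1, hc, ?_⟩
  intro i j hij haij
  have h := key i j
  rw [haij, mul_comm (α i j), sub_self, Matrix.one_apply_ne hij, mul_zero, zero_add] at h
  exact mul_ne_zero Complex.I_ne_zero
    (mul_ne_zero (hne i) (star_ne_zero.mpr (hne j))) h.symm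
end

section
/- Let n ≥ 1, let a : Fin n → ℝ be injective, let A = diagonal(a) (as a complex n×n matrix), let α be a Hermitian n×n complex matrix, and set Y = [A,α] = Aα − αA. Then the (necessarily real) trace of α² satisfies Tr(α²) = Σ_i ((α_{ii}).re)² + Σ_{i ≠ j} |Y_{ij}|² / (a_i − a_j)². Consequently the reduced Hamiltonian h = ½ Tr(α²) equals ½ Σ_i α_i² + ½ Σ_{i ≠ j} |Y_{ij}|²/(a_i − a_j)², where α_i = (α_{ii}).re. -/
open Matrix

/-- **Sections 5.7/5.9** (the reduced Hamiltonian): for `A = diagonal a` with distinct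
real entries, `α` Hermitian and `Y = [A,α]`,
`Tr(α²) = Σᵢ (Re αᵢᵢ)² + Σ_{i≠j} |Y_{ij}|²/(aᵢ-aⱼ)²`, and hence the Hamiltonian
`h = ½ Tr(α²)` equals `½ Σ αᵢ² + ½ Σ_{i≠j} |Y_{ij}|²/(aᵢ-aⱼ)²`. -/
theorem trace_sq_eq_calogero_moser_hamiltonian
    (n : ℕ) (hn : 1 ≤ n) (a : Fin n → ℝ) (ha : Function.Injective a)
    (α : Matrix (Fin n) (Fin n) ℂ) (hα : α.IsHermitian)
    (Y : Matrix (Fin n) (Fin n) ℂ)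
    (hY : Y = Matrix.diagonal (fun i => (a i : ℂ)) * α
        - α * Matrix.diagonal (fun i => (a i : ℂ)))
    (s : ℝ)
    (hs : s = ∑ i, ((α i i).re) ^ 2
        + ∑ i, ∑ j, if i = j then 0 else ‖Y i j‖ ^ 2 / (a i - a j) ^ 2) :
    (α * α).trace = (s : ℂ)
      ∧ (1 / 2 : ℂ) * (α * α).trace = (((1 / 2) * s : ℝ) : ℂ) := by
  have key : (α * α).trace = (s : ℂ) := by
    have h1 : ∀ i j, α i j * α j i = ((‖α i j‖ ^ 2 : ℝ) : ℂ) := by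
      intro i j
      rw [← hα.apply j i]
      have h := Complex.mul_conj' (α i j)
      push_cast
      exact h
    have h2 : ∀ i, ‖α i i‖ ^ 2 = (α i i).re ^ 2 := by
      intro i
      have him : (α i i).im = 0 := by
        have h := congrArg Complex.im (hα.apply i i)
        simp only [Complex.star_def, Complex.conj_im] at h
        linarith
      rw [Complex.sq_norm, Complex.normSq_apply, him]
      ring
    have h3 : ∀ i j, i ≠ j → ‖Y i j‖ ^ 2 / (a i - a j) ^ 2 = ‖α i j‖ ^ 2 := by
      intro i j hij
      have hne : a i - a j ≠ 0 := sub_ne_zero.mpr fun h => hij (ha h)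
      have hYij : Y i j = ((a i - a j : ℝ) : ℂ) * α i j := by
        rw [hY, Matrix.sub_apply, Matrix.diagonal_mul, Matrix.mul_diagonal]
        push_cast
        ring
      rw [hYij, norm_mul, mul_pow, Complex.norm_real, Real.norm_eq_abs, sq_abs]
      field_simp
    have h4 : s = ∑ i, ∑ j, ‖α i j‖ ^ 2 := by
      rw [hs, ← Finset.sum_add_distrib]
      refine Finset.sum_congr rfl fun i _ => ?_
      have h5 : ∀ j, ‖α i j‖ ^ 2 = (if i = j then (α i i).re ^ 2 else 0)
          + (if i = j then 0 else ‖Y i j‖ ^ 2 / (a i - a j) ^ 2) := by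
        intro j
        by_cases hij : i = j
        · subst hij
          simp [h2]
        · simp [hij, h3 i j hij]
      rw [Finset.sum_congr rfl fun j _ => h5 j, Finset.sum_add_distrib]
      simp
    rw [h4, Complex.ofReal_sum]
    simp only [Matrix.trace, Matrix.diag_apply, Matrix.mul_apply, h1, Complex.ofReal_sum]
  refine ⟨key, ?_⟩
  rw [key]
  push_cast
  ring
end

section
/- Assume the Hermitian diagonalization setup: A, α are Hermitian n×n complex matrices; g : ℝ → (n×n complex matrices) is differentiable with g(t) unitary for every t; a : ℝ → (Fin n → ℝ) has each coordinate differentiable; and for all t ∈ ℝ, g(t)·(A + t·α)·g(t)ᴴ = diagonal(a(t)). Then for every i and every t₀ ∈ ℝ, the derivative of a_i at t₀ equals the real part of the i-th diagonal entry of g(t₀)·α·g(t₀)ᴴ: a_i′(t₀) = ((g(t₀) α g(t₀)ᴴ)_{ii}).re. -/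
open Matrix

theorem entry_deriv_mul {n : ℕ} {M N : ℝ → Matrix (Fin n) (Fin n) ℂ}
    {dM dN : Matrix (Fin n) (Fin n) ℂ} {t : ℝ}
    (hM : ∀ i j, HasDerivAt (fun s => M s i j) (dM i j) t)
    (hN : ∀ i j, HasDerivAt (fun s => N s i j) (dN i j) t) (i j : Fin n) :
    HasDerivAt (fun s => (M s * N s) i j) ((dM * N t + M t * dN) i j) t := by
  simp only [Matrix.add_apply, Matrix.mul_apply, ← Finset.sum_add_distrib]
  exact HasDerivAt.fun_sum fun k _ => (hM i k).fun_mul (hN k j)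

/-- **Sections 5.7–5.9** (first-derivative identity `ȧᵢ = αᵢ`): in the Hermitian
diagonalization setup `g(t)(A + tα)g(t)ᴴ = diagonal (a t)` with `g(t)` unitary, the
derivative of the `i`-th eigenvalue is the real part of the `i`-th diagonal entry of
`g(t₀) α g(t₀)ᴴ`. -/
theorem eigenvalue_first_derivative
    (n : ℕ) (A α : Matrix (Fin n) (Fin n) ℂ)
    (hA : A.IsHermitian) (hα : α.IsHermitian)
    (g : ℝ → Matrix (Fin n) (Fin n) ℂ)
    (hg : ∀ i j, Differentiable ℝ (fun t => g t i j))
    (hgu : ∀ t : ℝ, g t * (g t)ᴴ = 1)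
    (a : ℝ → Fin n → ℝ)
    (ha : ∀ i, Differentiable ℝ (fun t => a t i))
    (hdiag : ∀ t : ℝ, g t * (A + t • α) * (g t)ᴴ
        = Matrix.diagonal (fun i => (a t i : ℂ)))
    (i : Fin n) (t₀ : ℝ) :
    deriv (fun t => a t i) t₀ = ((g t₀ * α * (g t₀)ᴴ) i i).re := by
  let dG : Matrix (Fin n) (Fin n) ℂ := Matrix.of fun i j => deriv (fun t => g t i j) t₀
  have hG : ∀ i j, HasDerivAt (fun s => g s i j) (dG i j) t₀ := fun i j =>
    (hg i j t₀).hasDerivAt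
  have hH : ∀ i j, HasDerivAt (fun s => (g s)ᴴ i j) (dGᴴ i j) t₀ := fun i j => by
    simp only [Matrix.conjTranspose_apply]
    exact (hG j i).star
  have hM : ∀ i j, HasDerivAt (fun s : ℝ => (A + s • α) i j) (α i j) t₀ := fun i j => by
    simp only [Matrix.add_apply, Matrix.smul_apply]
    simpa using ((hasDerivAt_id t₀).smul_const (α i j)).const_add (A i j)
  -- derivative of the unitarity relation
  have h1 := entry_deriv_mul hG hH i i
  simp only [hgu] at h1
  have h1e := h1.unique (hasDerivAt_const _ _)
  -- derivative of the diagonalization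
  have h2 := entry_deriv_mul (entry_deriv_mul hG hM) hH i i
  simp only [hdiag, Matrix.diagonal_apply_eq] at h2
  have h2e := h2.unique (ha i t₀).hasDerivAt.ofReal_comp
  have hu : (g t₀)ᴴ * g t₀ = 1 := mul_eq_one_comm.mp (hgu t₀)
  have hl : g t₀ * (A + t₀ • α) = Matrix.diagonal (fun i => (a t₀ i : ℂ)) * g t₀ := by
    rw [← hdiag, Matrix.mul_assoc _ _ (g t₀), hu, Matrix.mul_one]
  have hr : (A + t₀ • α) * (g t₀)ᴴ = (g t₀)ᴴ * Matrix.diagonal (fun i => (a t₀ i : ℂ)) := by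
    rw [← hdiag, ← Matrix.mul_assoc, ← Matrix.mul_assoc, hu, Matrix.one_mul]
  rw [Matrix.add_mul, hl, Matrix.mul_assoc dG, hr, ← Matrix.mul_assoc dG, Matrix.mul_assoc _ (g t₀) dGᴴ] at h2e
  simp only [Matrix.add_apply, Matrix.mul_diagonal, Matrix.diagonal_mul] at h2e h1e
  have h3 : (g t₀ * α * (g t₀)ᴴ) i i = ((deriv (fun t => a t i) t₀ : ℝ) : ℂ) := by
    rw [← h2e]
    linear_combination (-(a t₀ i : ℂ)) * h1e
  rw [h3, Complex.ofReal_re]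
end

section
/- Assume the Hermitian diagonalization setup: A, α are Hermitian n×n complex matrices; g : ℝ → (n×n complex matrices) is differentiable with g(t) unitary for every t; a : ℝ → (Fin n → ℝ) has each coordinate differentiable; and for all t ∈ ℝ, g(t)·(A + t·α)·g(t)ᴴ = diagonal(a(t)). Define Y(t) = g(t)·[A,α]·g(t)ᴴ. Let t₀ ∈ ℝ be such that the values a_i(t₀), i = 1,…,n, are pairwise distinct. Then for each i the function t ↦ a_i′(t) (the derivative of a_i) is differentiable at t₀ with derivative a_i″(t₀) = 2·Σ_{j ≠ i} |Y(t₀)_{ij}|² / (a_i(t₀) − a_j(t₀))³. (This is the spin Calogero–Moser equation satisfied by the eigenvalue curve of the straight line A + tα.) -/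
open Matrix

/-- Entrywise derivative of a matrix-valued curve. -/
def EntryDeriv {n : ℕ} (M : ℝ → Matrix (Fin n) (Fin n) ℂ) (dM : Matrix (Fin n) (Fin n) ℂ)
    (t : ℝ) : Prop :=
  ∀ i j, HasDerivAt (fun s => M s i j) (dM i j) t

theorem EntryDeriv.mul {n : ℕ} {M N : ℝ → Matrix (Fin n) (Fin n) ℂ}
    {dM dN : Matrix (Fin n) (Fin n) ℂ} {t : ℝ}
    (hM : EntryDeriv M dM t) (hN : EntryDeriv N dN t) :
    EntryDeriv (fun s => M s * N s) (dM * N t + M t * dN) t := by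
  intro i j
  simp only [Matrix.mul_apply, Matrix.add_apply, ← Finset.sum_add_distrib]
  exact HasDerivAt.fun_sum fun k _ => (hM i k).mul (hN k j)

theorem EntryDeriv.const {n : ℕ} (M : Matrix (Fin n) (Fin n) ℂ) (t : ℝ) :
    EntryDeriv (fun _ => M) 0 t := fun i j => hasDerivAt_const t (M i j)

theorem EntryDeriv.star {n : ℕ} {M : ℝ → Matrix (Fin n) (Fin n) ℂ}
    {dM : Matrix (Fin n) (Fin n) ℂ} {t : ℝ} (hM : EntryDeriv M dM t) :
    EntryDeriv (fun s => (M s)ᴴ) (dMᴴ) t := fun i j => (hM j i).star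

theorem EntryDeriv.unique {n : ℕ} {M : ℝ → Matrix (Fin n) (Fin n) ℂ}
    {dM dN : Matrix (Fin n) (Fin n) ℂ} {t : ℝ} (hM : EntryDeriv M dM t)
    (hN : EntryDeriv M dN t) : dM = dN := by
  ext i j
  exact (hM i j).unique (hN i j)

/-- **Section 5.9** (spin Calogero–Moser equation for the eigenvalues): in the Hermitian
diagonalization setup `g(t)(A + tα)g(t)ᴴ = diagonal (a t)` with `g(t)` unitary and
`Y(t) = g(t)[A,α]g(t)ᴴ`, at a time `t₀` where the eigenvalues are pairwise distinct each
`aᵢ'` is differentiable with `aᵢ''(t₀) = 2 Σ_{j≠i} |Y(t₀)_{ij}|²/(aᵢ(t₀)-aⱼ(t₀))³`. -/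
theorem eigenvalue_second_derivative_spin_calogero_moser
    (n : ℕ) (A α : Matrix (Fin n) (Fin n) ℂ)
    (hA : A.IsHermitian) (hα : α.IsHermitian)
    (g : ℝ → Matrix (Fin n) (Fin n) ℂ)
    (hg : ∀ i j, Differentiable ℝ (fun t => g t i j))
    (hgu : ∀ t : ℝ, g t * (g t)ᴴ = 1)
    (a : ℝ → Fin n → ℝ)
    (ha : ∀ i, Differentiable ℝ (fun t => a t i))
    (hdiag : ∀ t : ℝ, g t * (A + t • α) * (g t)ᴴ
        = Matrix.diagonal (fun i => (a t i : ℂ)))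
    (Y : ℝ → Matrix (Fin n) (Fin n) ℂ)
    (hYdef : ∀ t, Y t = g t * (A * α - α * A) * (g t)ᴴ)
    (t₀ : ℝ)
    (hsep : ∀ i j, i ≠ j → a t₀ i ≠ a t₀ j) :
    ∀ i, HasDerivAt (deriv fun t => a t i)
      (2 * ∑ j ∈ Finset.univ.erase i,
        ‖Y t₀ i j‖ ^ 2 / (a t₀ i - a t₀ j) ^ 3) t₀ := by
  have hguAlt : ∀ t, (g t)ᴴ * g t = 1 := fun t => mul_eq_one_comm.mp (hgu t)
  let G : ℝ → Matrix (Fin n) (Fin n) ℂ := fun t => Matrix.of fun i j => deriv (fun s => g s i j) t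
  have hG : ∀ t, EntryDeriv g (G t) t := fun t i j => (hg i j t).hasDerivAt
  let X : ℝ → Matrix (Fin n) (Fin n) ℂ := fun t => G t * (g t)ᴴ
  let B : ℝ → Matrix (Fin n) (Fin n) ℂ := fun t => g t * α * (g t)ᴴ
  have hGX : ∀ t, G t = X t * g t := fun t => by
    simp only [X, Matrix.mul_assoc, hguAlt, Matrix.mul_one]
  have hXs : ∀ t, g t * (G t)ᴴ = - X t := fun t => by
    have h := (hG t).mul (hG t).star
    simp only [hgu] at h
    have h2 := h.unique (EntryDeriv.const 1 t)
    exact eq_neg_of_add_eq_zero_right h2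
  have hGs : ∀ t, (G t)ᴴ = - ((g t)ᴴ * X t) := fun t => by
    rw [← Matrix.mul_neg, ← hXs, ← Matrix.mul_assoc, hguAlt, Matrix.one_mul]
  have hB : ∀ t, EntryDeriv B (X t * B t - B t * X t) t := fun t => by
    have h := ((hG t).mul (EntryDeriv.const α t)).mul (hG t).star
    convert h using 1
    rw [hGs, hGX]
    simp only [B, Matrix.mul_zero, add_zero, Matrix.mul_neg, Matrix.mul_assoc, sub_eq_add_neg]
  have hlin : ∀ t : ℝ, EntryDeriv (fun s : ℝ => A + s • α) α t := fun t i j => by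
    have h := ((hasDerivAt_id t).smul_const (α i j)).const_add (A i j)
    simpa using h
  let D : ℝ → Matrix (Fin n) (Fin n) ℂ := fun t => Matrix.diagonal (fun i => (a t i : ℂ))
  have hD : ∀ t, EntryDeriv D (X t * D t + B t - D t * X t) t := fun t => by
    have h := ((hG t).mul (hlin t)).mul (hG t).star
    simp only [hdiag] at h
    convert h using 1
    simp only [D]
    rw [← hdiag t, hGs, hGX]
    simp only [B]
    noncomm_ring
  have hdii : ∀ t i, deriv (fun s => a s i) t = (B t i i).re := fun t i => by
    have h := hD t i i
    have h1 : HasDerivAt (fun s => ((a s i : ℝ) : ℂ)) ((deriv (fun s => a s i) t : ℝ) : ℂ) t :=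
      ((ha i t).hasDerivAt).ofReal_comp
    simp only [D, Matrix.diagonal_apply_eq, Matrix.sub_apply, Matrix.add_apply,
      Matrix.mul_diagonal, Matrix.diagonal_mul] at h
    have h2 := congrArg Complex.re (h1.unique h)
    rw [Complex.ofReal_re] at h2
    rw [h2]
    congr 1
    ring
  have hoff : ∀ t i j, i ≠ j → B t i j = ((a t i : ℂ) - a t j) * X t i j := fun t i j hij => by
    have h := hD t i j
    simp only [D, Matrix.diagonal_apply_ne _ hij, Matrix.sub_apply, Matrix.add_apply,
      Matrix.mul_diagonal, Matrix.diagonal_mul] at h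
    have h2 := h.unique (hasDerivAt_const t (0 : ℂ))
    linear_combination h2
  have hBH : ∀ t, (B t)ᴴ = B t := fun t => by
    simp only [B, Matrix.conjTranspose_mul, Matrix.conjTranspose_conjTranspose, hα.eq,
      Matrix.mul_assoc]
  have hY : ∀ t, Y t = D t * B t - B t * D t := fun t => by
    have e : ∀ P Q : Matrix (Fin n) (Fin n) ℂ,
        (g t * P * (g t)ᴴ) * (g t * Q * (g t)ᴴ) = g t * (P * Q) * (g t)ᴴ := fun P Q => by
      calc _ = g t * P * ((g t)ᴴ * g t) * Q * (g t)ᴴ := by noncomm_ring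
        _ = _ := by rw [hguAlt]; noncomm_ring
    rw [hYdef]
    simp only [D, B]
    rw [← hdiag t, e, e, ← Matrix.sub_mul, ← Matrix.mul_sub]
    congr 2
    simp only [Matrix.add_mul, Matrix.mul_add, Matrix.smul_mul, Matrix.mul_smul]
    abel
  intro i
  have hfun : (deriv fun t => a t i) = fun t => (B t i i).re := funext fun t => hdii t i
  rw [hfun]
  have hre : HasDerivAt (fun t => (B t i i).re) ((X t₀ * B t₀ - B t₀ * X t₀) i i).re t₀ :=
    Complex.reCLM.hasFDerivAt.comp_hasDerivAt t₀ (hB t₀ i i)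
  convert hre using 1
  rw [Matrix.sub_apply, Matrix.mul_apply, Matrix.mul_apply, ← Finset.sum_sub_distrib,
    ← Finset.sum_erase_add _ _ (Finset.mem_univ i), mul_comm (X t₀ i i), sub_self, add_zero,
    Complex.re_sum, Finset.mul_sum]
  refine Finset.sum_congr rfl fun j hj => ?_
  have hij : i ≠ j := (Finset.ne_of_mem_erase hj).symm
  have hr : a t₀ i - a t₀ j ≠ 0 := sub_ne_zero.mpr (hsep i j hij)
  have hc : ((a t₀ i - a t₀ j : ℝ) : ℂ) ≠ 0 := by exact_mod_cast hr
  have hYij : Y t₀ i j = ((a t₀ i - a t₀ j : ℝ) : ℂ) * B t₀ i j := by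
    rw [hY]
    simp only [D, Matrix.sub_apply, Matrix.mul_diagonal, Matrix.diagonal_mul]
    push_cast
    ring
  have hBji : B t₀ j i = star (B t₀ i j) := by
    conv_lhs => rw [← hBH]
    rfl
  have hXij : X t₀ i j = B t₀ i j / ((a t₀ i - a t₀ j : ℝ) : ℂ) := by
    rw [eq_div_iff hc, hoff t₀ i j hij]
    push_cast
    ring
  have hXji : X t₀ j i = - (B t₀ j i / ((a t₀ i - a t₀ j : ℝ) : ℂ)) := by
    rw [← neg_div, eq_div_iff hc, hoff t₀ j i hij.symm]
    push_cast
    ring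
  have hnorm : B t₀ i j * star (B t₀ i j) = ((‖B t₀ i j‖ ^ 2 : ℝ) : ℂ) := by
    rw [Complex.star_def, Complex.mul_conj, Complex.normSq_eq_norm_sq]
  have key : X t₀ i j * B t₀ j i - B t₀ i j * X t₀ j i
      = ((2 * (‖B t₀ i j‖ ^ 2 / (a t₀ i - a t₀ j)) : ℝ) : ℂ) := by
    rw [hXij, hXji, hBji]
    rw [Complex.ofReal_mul, Complex.ofReal_div, ← hnorm]
    push_cast
    ring
  rw [key, Complex.ofReal_re, hYij, norm_mul, Complex.norm_real, mul_pow, Real.norm_eq_abs, sq_abs]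
  field_simp
end

section
/- Assume the Hermitian diagonalization setup: A, α are Hermitian n×n complex matrices; g : ℝ → (n×n complex matrices) is differentiable with g(t) unitary for every t; a : ℝ → (Fin n → ℝ) has each coordinate differentiable; and for all t ∈ ℝ, g(t)·(A + t·α)·g(t)ᴴ = diagonal(a(t)). Define Y(t) = g(t)·[A,α]·g(t)ᴴ. Let t₀ ∈ ℝ be such that the a_i(t₀) are pairwise distinct and such that the gauge condition holds: every diagonal entry of (g′(t₀))·g(t₀)ᴴ is zero. Define the matrix Z by Z_{ij} = Y(t₀)_{ij}/(a_i(t₀) − a_j(t₀))² for i ≠ j and Z_{ii} = 0. Then Y is differentiable at t₀ with Y′(t₀) = Z·Y(t₀) − Y(t₀)·Z = [Y(t₀)ᴴ, Z]. -/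
open Matrix

/-- Entrywise product rule for matrix-valued functions. -/
lemma hasDerivAt_entry_mul {n : ℕ} {M N : ℝ → Matrix (Fin n) (Fin n) ℂ}
    {M' N' : Matrix (Fin n) (Fin n) ℂ} {t : ℝ}
    (hM : ∀ i j, HasDerivAt (fun s => M s i j) (M' i j) t)
    (hN : ∀ i j, HasDerivAt (fun s => N s i j) (N' i j) t) (i j : Fin n) :
    HasDerivAt (fun s => (M s * N s) i j) ((M' * N t + M t * N') i j) t := by
  simp only [Matrix.mul_apply, Matrix.add_apply, ← Finset.sum_add_distrib]
  exact HasDerivAt.fun_sum fun k _ => (hM i k).mul (hN k j)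


/-- **Section 5.9** (spin evolution `Ẏ = [Y*,Z]`): in the Hermitian diagonalization
setup, with `Y(t) = g(t)[A,α]g(t)ᴴ`, at a time `t₀` with pairwise distinct eigenvalues
and the gauge condition `diag(g'(t₀)g(t₀)ᴴ) = 0`, the momentum `Y` is differentiable
with `Y'(t₀) = Z·Y(t₀) − Y(t₀)·Z = [Y(t₀)ᴴ, Z]`, where `Z_{ij} = Y(t₀)_{ij}/(aᵢ-aⱼ)²`
off the diagonal and `Z_{ii} = 0`. -/
theorem momentum_evolution_spin_calogero_moser
    (n : ℕ) (A α : Matrix (Fin n) (Fin n) ℂ)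
    (hA : A.IsHermitian) (hα : α.IsHermitian)
    (g g' : ℝ → Matrix (Fin n) (Fin n) ℂ)
    (hg' : ∀ i j, ∀ t : ℝ, HasDerivAt (fun s => g s i j) (g' t i j) t)
    (hgu : ∀ t : ℝ, g t * (g t)ᴴ = 1)
    (a : ℝ → Fin n → ℝ)
    (ha : ∀ i, Differentiable ℝ (fun t => a t i))
    (hdiag : ∀ t : ℝ, g t * (A + t • α) * (g t)ᴴ
        = Matrix.diagonal (fun i => (a t i : ℂ)))
    (Y : ℝ → Matrix (Fin n) (Fin n) ℂ)
    (hYdef : ∀ t, Y t = g t * (A * α - α * A) * (g t)ᴴ)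
    (t₀ : ℝ)
    (hsep : ∀ i j, i ≠ j → a t₀ i ≠ a t₀ j)
    (hgauge : ∀ i, (g' t₀ * (g t₀)ᴴ) i i = 0)
    (Z : Matrix (Fin n) (Fin n) ℂ)
    (hZ : Z = Matrix.of fun i j =>
      if i = j then 0 else Y t₀ i j / (((a t₀ i : ℂ) - (a t₀ j : ℂ)) ^ 2)) :
    (∀ i j, HasDerivAt (fun t => Y t i j) ((Z * Y t₀ - Y t₀ * Z) i j) t₀)
      ∧ Z * Y t₀ - Y t₀ * Z = (Y t₀)ᴴ * Z - Z * (Y t₀)ᴴ := by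
  have hK : ∀ i j, HasDerivAt (fun s => (g s)ᴴ i j) ((g' t₀)ᴴ i j) t₀ := by
    intro i j
    simpa only [Matrix.conjTranspose_apply] using (hg' j i t₀).star
  have hG : ∀ i j, HasDerivAt (fun s => g s i j) (g' t₀ i j) t₀ := fun i j => hg' i j t₀
  have hu := hgu t₀
  have hu' : (g t₀)ᴴ * g t₀ = 1 := mul_eq_one_comm.mp hu
  have h0 : g' t₀ * (g t₀)ᴴ + g t₀ * (g' t₀)ᴴ = 0 := by
    ext i j
    have h := hasDerivAt_entry_mul hG hK i j
    simp only [hgu] at h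
    exact h.unique (hasDerivAt_const _ _)
  obtain ⟨W, hW⟩ : ∃ W, W = g' t₀ * (g t₀)ᴴ := ⟨_, rfl⟩
  have hG' : g' t₀ = W * g t₀ := by
    rw [hW, Matrix.mul_assoc, hu', Matrix.mul_one]
  have hK' : (g' t₀)ᴴ = - ((g t₀)ᴴ * W) := by
    have h1 : g t₀ * (g' t₀)ᴴ = - W := by
      rw [hW]; exact eq_neg_of_add_eq_zero_right h0
    rw [← Matrix.mul_neg, ← h1, ← Matrix.mul_assoc, hu', Matrix.one_mul]
  have hconj : ∀ (M : ℝ → Matrix (Fin n) (Fin n) ℂ) (M' : Matrix (Fin n) (Fin n) ℂ),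
      (∀ i j, HasDerivAt (fun s => M s i j) (M' i j) t₀) → ∀ i j,
      HasDerivAt (fun s => (g s * M s * (g s)ᴴ) i j)
        ((W * (g t₀ * M t₀ * (g t₀)ᴴ) - (g t₀ * M t₀ * (g t₀)ᴴ) * W
          + g t₀ * M' * (g t₀)ᴴ) i j) t₀ := by
    intro M M' hM i j
    have h := hasDerivAt_entry_mul (fun i j => hasDerivAt_entry_mul hG hM i j) hK i j
    rw [hK', hG'] at h
    have e : W * (g t₀ * M t₀ * (g t₀)ᴴ) - (g t₀ * M t₀ * (g t₀)ᴴ) * W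
          + g t₀ * M' * (g t₀)ᴴ = (W * g t₀ * M t₀ + g t₀ * M') * (g t₀)ᴴ
          + g t₀ * M t₀ * -((g t₀)ᴴ * W) := by
      noncomm_ring
    rw [e]
    exact h
  obtain ⟨L, hL⟩ : ∃ L, L = g t₀ * α * (g t₀)ᴴ := ⟨_, rfl⟩
  have hYL : Y t₀ = Matrix.diagonal (fun i => (a t₀ i : ℂ)) * L
      - L * Matrix.diagonal (fun i => (a t₀ i : ℂ)) := by
    have e : ∀ P Q : Matrix (Fin n) (Fin n) ℂ,
        (g t₀ * P * (g t₀)ᴴ) * (g t₀ * Q * (g t₀)ᴴ) = g t₀ * (P * Q) * (g t₀)ᴴ := by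
      intro P Q
      calc _ = g t₀ * P * ((g t₀)ᴴ * g t₀) * Q * (g t₀)ᴴ := by noncomm_ring
        _ = _ := by rw [hu']; noncomm_ring
    rw [hYdef, ← hdiag, hL, e, e, ← Matrix.sub_mul, ← Matrix.mul_sub]
    congr 2
    rw [Matrix.add_mul, Matrix.mul_add, Matrix.smul_mul, Matrix.mul_smul]
    abel
  have hWZ : W = Z := by
    ext i j
    rw [hZ, Matrix.of_apply]
    split_ifs with hij
    · subst hij; rw [hW]; exact hgauge i
    · have hM : ∀ i j, HasDerivAt (fun s : ℝ => (A + s • α) i j) (α i j) t₀ := by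
        intro i j
        simp only [Matrix.add_apply, Matrix.smul_apply]
        simpa using ((hasDerivAt_id t₀).smul_const (α i j)).const_add (A i j)
      have h := hconj _ _ hM i j
      simp only [hdiag, Matrix.diagonal_apply_ne _ hij] at h
      have h2 := h.unique (hasDerivAt_const _ _)
      rw [← hL] at h2
      simp only [Matrix.add_apply, Matrix.sub_apply, Matrix.mul_diagonal,
        Matrix.diagonal_mul] at h2
      have hne : (a t₀ i : ℂ) - (a t₀ j : ℂ) ≠ 0 := by
        rw [sub_ne_zero]; exact_mod_cast hsep i j hij
      rw [eq_div_iff (pow_ne_zero 2 hne), hYL]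
      simp only [Matrix.sub_apply, Matrix.mul_diagonal, Matrix.diagonal_mul]
      linear_combination (-((a t₀ i : ℂ) - (a t₀ j : ℂ))) * h2
  constructor
  · intro i j
    have h := hconj (fun _ => A * α - α * A) 0 (fun i j => hasDerivAt_const _ _) i j
    simp only [← hYdef, hWZ, Matrix.mul_zero, Matrix.zero_mul, add_zero] at h
    exact h
  · have hskew : (Y t₀)ᴴ = - Y t₀ := by
      rw [hYdef]
      simp only [Matrix.conjTranspose_mul, Matrix.conjTranspose_sub,
        Matrix.conjTranspose_conjTranspose, hA.eq, hα.eq]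
      noncomm_ring
    rw [hskew]
    noncomm_ring
end

section
/- Assume the symmetric diagonalization setup: A, α are real symmetric n×n matrices; g : ℝ → (n×n real matrices) is differentiable with g(t) orthogonal (g(t)·g(t)ᵀ = 1) for every t; a : ℝ → (Fin n → ℝ) has each coordinate differentiable; and for all t ∈ ℝ, g(t)·(A + t·α)·g(t)ᵀ = diagonal(a(t)). Define Y(t) = g(t)·[A,α]·g(t)ᵀ. Let t₀ ∈ ℝ be such that the a_i(t₀) are pairwise distinct. Then: (a) for each i, a_i′ is differentiable at t₀ with a_i″(t₀) = 2·Σ_{j ≠ i} Y(t₀)_{ij}² / (a_i(t₀) − a_j(t₀))³; and (b) if in addition every diagonal entry of g′(t₀)·g(t₀)ᵀ vanishes, then Y′(t₀) = [Y(t₀), Z] where Z_{ij} = −Y(t₀)_{ij}/(a_i(t₀) − a_j(t₀))² for i ≠ j and Z_{ii} = 0. -/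
open Matrix

theorem hasDerivAt_mul_entry {n : ℕ} {u v : ℝ → Matrix (Fin n) (Fin n) ℝ}
    {u' v' : Matrix (Fin n) (Fin n) ℝ} {t : ℝ}
    (hu : ∀ i j, HasDerivAt (fun s => u s i j) (u' i j) t)
    (hv : ∀ i j, HasDerivAt (fun s => v s i j) (v' i j) t) (i j : Fin n) :
    HasDerivAt (fun s => (u s * v s) i j) ((u' * v t + u t * v') i j) t := by
  simp only [Matrix.add_apply, Matrix.mul_apply, ← Finset.sum_add_distrib]
  exact HasDerivAt.fun_sum fun k _ => (hu i k).mul (hv k j)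

/-- Conjugation derivative formula. -/
theorem hasDerivAt_conj_entry {n : ℕ} {g m : ℝ → Matrix (Fin n) (Fin n) ℝ}
    {g' m' : Matrix (Fin n) (Fin n) ℝ} {t : ℝ}
    (hg : ∀ i j, HasDerivAt (fun s => g s i j) (g' i j) t)
    (hgo : ∀ t : ℝ, g t * (g t)ᵀ = 1)
    (hm : ∀ i j, HasDerivAt (fun s => m s i j) (m' i j) t) (i j : Fin n) :
    HasDerivAt (fun s => (g s * m s * (g s)ᵀ) i j)
      (((g' * (g t)ᵀ) * (g t * m t * (g t)ᵀ) - (g t * m t * (g t)ᵀ) * (g' * (g t)ᵀ)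
        + g t * m' * (g t)ᵀ) i j) t := by
  have hT : ∀ i j, HasDerivAt (fun s => (g s)ᵀ i j) (g'ᵀ i j) t := fun i j => hg j i
  have h := hasDerivAt_mul_entry (hasDerivAt_mul_entry hg hm) hT i j
  have hgo' : (g t)ᵀ * g t = 1 := mul_eq_one_comm.mp (hgo t)
  have hs : g' * (g t)ᵀ + g t * g'ᵀ = 0 := by
    ext i j
    have h1 := hasDerivAt_mul_entry hg hT i j
    simp only [hgo] at h1
    exact h1.unique (hasDerivAt_const _ _)
  have h2 : g'ᵀ = -((g t)ᵀ * (g' * (g t)ᵀ)) := by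
    rw [eq_neg_of_add_eq_zero_left hs, Matrix.mul_neg, neg_neg, ← Matrix.mul_assoc, hgo',
      Matrix.one_mul]
  have h3 : (g t)ᵀ * (g t * (m t * (g t)ᵀ)) = m t * (g t)ᵀ := by
    rw [← Matrix.mul_assoc, hgo', Matrix.one_mul]
  convert h using 1
  refine congrFun (congrFun ?_ i) j
  rw [h2]
  simp only [Matrix.mul_assoc, Matrix.add_mul, Matrix.mul_neg, h3]
  abel

/-- **Section 5.11** (symmetric matrices): in the real symmetric diagonalization setup
`g(t)(A + tα)g(t)ᵀ = diagonal (a t)` with `g(t)` orthogonal and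
`Y(t) = g(t)[A,α]g(t)ᵀ`, at a time `t₀` with pairwise distinct eigenvalues:
(a) `aᵢ''(t₀) = 2 Σ_{j≠i} Y(t₀)_{ij}²/(aᵢ-aⱼ)³`, and
(b) under the gauge condition `diag(g'(t₀)g(t₀)ᵀ) = 0`, `Y'(t₀) = [Y(t₀), Z]` where
`Z_{ij} = −Y(t₀)_{ij}/(aᵢ-aⱼ)²` off the diagonal and `Z_{ii} = 0`. -/
theorem real_spin_calogero_moser_symmetric_matrices
    (n : ℕ) (A α : Matrix (Fin n) (Fin n) ℝ)
    (hA : Aᵀ = A) (hα : αᵀ = α)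
    (g g' : ℝ → Matrix (Fin n) (Fin n) ℝ)
    (hg' : ∀ i j, ∀ t : ℝ, HasDerivAt (fun s => g s i j) (g' t i j) t)
    (hgo : ∀ t : ℝ, g t * (g t)ᵀ = 1)
    (a : ℝ → Fin n → ℝ)
    (ha : ∀ i, Differentiable ℝ (fun t => a t i))
    (hdiag : ∀ t : ℝ, g t * (A + t • α) * (g t)ᵀ = Matrix.diagonal (a t))
    (Y : ℝ → Matrix (Fin n) (Fin n) ℝ)
    (hYdef : ∀ t, Y t = g t * (A * α - α * A) * (g t)ᵀ)
    (t₀ : ℝ)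
    (hsep : ∀ i j, i ≠ j → a t₀ i ≠ a t₀ j)
    (Z : Matrix (Fin n) (Fin n) ℝ)
    (hZ : Z = Matrix.of fun i j =>
      if i = j then 0 else -(Y t₀ i j) / ((a t₀ i - a t₀ j) ^ 2)) :
    (∀ i, HasDerivAt (deriv fun t => a t i)
        (2 * ∑ j ∈ Finset.univ.erase i,
          (Y t₀ i j) ^ 2 / (a t₀ i - a t₀ j) ^ 3) t₀)
      ∧ ((∀ i, (g' t₀ * (g t₀)ᵀ) i i = 0) →
          ∀ i j, HasDerivAt (fun t => Y t i j)
            ((Y t₀ * Z - Z * Y t₀) i j) t₀) := by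
  have hgo' : ∀ t, (g t)ᵀ * g t = 1 := fun t => mul_eq_one_comm.mp (hgo t)
  set X : ℝ → Matrix (Fin n) (Fin n) ℝ := fun t => g' t * (g t)ᵀ with hX
  set B : ℝ → Matrix (Fin n) (Fin n) ℝ := fun t => g t * α * (g t)ᵀ with hB
  have hconst : ∀ (M : Matrix (Fin n) (Fin n) ℝ) (t : ℝ) (i j : Fin n),
      HasDerivAt (fun s => (g s * M * (g s)ᵀ) i j)
        ((X t * (g t * M * (g t)ᵀ) - (g t * M * (g t)ᵀ) * X t) i j) t := by
    intro M t i j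
    have h := hasDerivAt_conj_entry (m := fun _ => M) (m' := 0) (fun i j => hg' i j t) hgo
      (fun i j => hasDerivAt_const _ _) i j
    simpa using h
  have hD : ∀ t i j, HasDerivAt (fun s => Matrix.diagonal (a s) i j)
      ((X t * Matrix.diagonal (a t) - Matrix.diagonal (a t) * X t + B t) i j) t := by
    intro t i j
    have h := hasDerivAt_conj_entry (m := fun s => A + s • α) (m' := α)
      (fun i j => hg' i j t) hgo
      (fun i j => by
        have := ((hasDerivAt_id t).mul_const (α i j)).const_add (A i j)
        simpa using this) i j
    simpa only [hdiag] using h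
  have ha' : ∀ i, (deriv fun t => a t i) = fun t => B t i i := by
    intro i
    funext t
    have h := hD t i i
    simp only [Matrix.diagonal_apply_eq, Matrix.add_apply, Matrix.sub_apply,
      Matrix.mul_diagonal, Matrix.diagonal_mul] at h
    rw [h.deriv]
    ring
  have hoff : ∀ i j, i ≠ j → X t₀ i j * (a t₀ i - a t₀ j) = B t₀ i j := by
    intro i j hij
    have h := hD t₀ i j
    simp only [Matrix.diagonal_apply_ne _ hij, Matrix.add_apply, Matrix.sub_apply,
      Matrix.mul_diagonal, Matrix.diagonal_mul] at h
    have := h.unique (hasDerivAt_const _ _)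
    linarith
  have hYB : ∀ i j, Y t₀ i j = (a t₀ i - a t₀ j) * B t₀ i j := by
    intro i j
    have h : Y t₀ = Matrix.diagonal (a t₀) * B t₀ - B t₀ * Matrix.diagonal (a t₀) := by
      have hc : ∀ M N : Matrix (Fin n) (Fin n) ℝ,
          (g t₀ * M * (g t₀)ᵀ) * (g t₀ * N * (g t₀)ᵀ) = g t₀ * (M * N) * (g t₀)ᵀ := by
        intro M N
        have : (g t₀)ᵀ * (g t₀ * (N * (g t₀)ᵀ)) = N * (g t₀)ᵀ := by
          rw [← Matrix.mul_assoc, hgo', Matrix.one_mul]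
        simp only [Matrix.mul_assoc, this]
      rw [hYdef, ← hdiag, hB]
      simp only [hc]
      rw [← Matrix.sub_mul, ← Matrix.mul_sub]
      congr 2
      simp [Matrix.add_mul, Matrix.mul_add]
    rw [h]
    simp only [Matrix.sub_apply, Matrix.mul_diagonal, Matrix.diagonal_mul]
    ring
  have hBs : ∀ i j, B t₀ j i = B t₀ i j := by
    intro i j
    have h : (B t₀)ᵀ = B t₀ := by
      simp [hB, Matrix.transpose_mul, hα, Matrix.mul_assoc]
    exact congrFun (congrFun h i) j
  refine ⟨fun i => ?_, fun h0 i j => ?_⟩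
  · rw [ha' i]
    convert hconst α t₀ i i using 1
    change _ = (X t₀ * B t₀ - B t₀ * X t₀) i i
    rw [Matrix.sub_apply, Matrix.mul_apply, Matrix.mul_apply, ← Finset.sum_sub_distrib,
      ← Finset.add_sum_erase _ _ (Finset.mem_univ i), Finset.mul_sum]
    rw [mul_comm (B t₀ i i), sub_self, zero_add]
    refine Finset.sum_congr rfl fun j hj => ?_
    have hij : i ≠ j := (Finset.ne_of_mem_erase hj).symm
    have hne : a t₀ i - a t₀ j ≠ 0 := sub_ne_zero.mpr (hsep i j hij)
    have h1 := hoff i j hij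
    have h2 := hoff j i hij.symm
    have h3 : X t₀ j i = - X t₀ i j := by
      apply mul_right_cancel₀ hne
      rw [hBs i j] at h2
      linarith
    rw [hYB, hBs i j, h3, ← h1]
    field_simp
    ring
  · have hZX : Z = - X t₀ := by
      ext i j
      rw [hZ, Matrix.of_apply, Matrix.neg_apply]
      split_ifs with hij
      · subst hij
        rw [show X t₀ i i = 0 from h0 i, neg_zero]
      · have hne : a t₀ i - a t₀ j ≠ 0 := sub_ne_zero.mpr (hsep i j hij)
        rw [hYB, ← hoff i j hij]
        field_simp
    have h := hconst (A * α - α * A) t₀ i j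
    simp only [← hYdef] at h
    convert h using 1
    refine congrFun (congrFun ?_ i) j
    rw [hZX, Matrix.mul_neg, Matrix.neg_mul]
    abel
end
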